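/- arXiv:1304.3052 — 2 statements merged into one kernel-verified Lean document; each statement's English description precedes it below -/
import Mathlib

section
/- Let K be a number field or a function field of characteristic 0, let 𝔭 be a non-archimedean place of K with valuation ring 𝒪_𝔭, let 𝒳 be a separated scheme of finite type over 𝒪_𝔭, let φ be an endomorphism of 𝒳 over 𝒪_𝔭, and let P ∈ 𝒳(𝒪_𝔭). Assume 𝒳 is smooth over 𝒪_𝔭 and φ is étale at (the closed point of) every point in the orbit O_φ(P), and let 𝒱 be a reduced closed subscheme of 𝒳. Assume either (a) there exists M > 0 with φ^M(𝒱) ⊆ 𝒱, and additionally, when K is a function field, the reduction of P modulo 𝔭 is φ-preperiodic; or (b) 𝒱 is a finite set of φ-preperiodic points of 𝒳(𝒪_𝔭). Then if 𝒱(𝒪_𝔭) does not intersect O_φ(P), it does not intersect the 𝔭-adic closure of O_φ(P). -/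
/-- A place of a field `K`, represented by a nontrivial absolute value. -/
structure PlaceK (K : Type) [Field K] where
  v : AbsoluteValue K ℝ
  nontrivial : ∃ x : K, x ≠ 0 ∧ v x ≠ 1

/-- A place is non-archimedean if its absolute value satisfies the ultrametric inequality. -/
def PlaceK.IsNonarch {K : Type} [Field K] (w : PlaceK K) : Prop :=
  ∀ x y : K, w.v (x + y) ≤ max (w.v x) (w.v y)

/-- Equivalence of places (equality of the associated topologies / unit balls). -/
def PlaceK.Equiv {K : Type} [Field K] (w w' : PlaceK K) : Prop :=
  ∀ x : K, w.v x < 1 ↔ w'.v x < 1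

/-- A choice of completion of `K` at a place `w`: a field `carrier` with an absolute value
extending that of `w` through `emb`, which is complete and in which `K` is dense. -/
structure CompletionOf {K : Type} [Field K] (w : PlaceK K) where
  carrier : Type
  [field : Field carrier]
  emb : K →+* carrier
  absv : AbsoluteValue carrier ℝ
  compat : ∀ x : K, absv (emb x) = w.v x
  complete : ∀ s : ℕ → carrier,
    (∀ ε : ℝ, 0 < ε → ∃ N : ℕ, ∀ m ≥ N, ∀ k ≥ N, absv (s m - s k) < ε) →
    ∃ a : carrier, ∀ ε : ℝ, 0 < ε → ∃ N : ℕ, ∀ m ≥ N, absv (s m - a) < ε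
  dense : ∀ a : carrier, ∀ ε : ℝ, 0 < ε → ∃ x : K, absv (a - emb x) < ε

attribute [instance] CompletionOf.field

/-- The chordal metric on `P^1(L)` attached to an absolute value on `L`. -/
noncomputable def p1Dist {L : Type} [Field L] (w : AbsoluteValue L ℝ) :
    OnePoint L → OnePoint L → ℝ :=
  fun x y =>
    Option.elim x
      (Option.elim y 0 fun b => 1 / max 1 (w b))
      (fun a => Option.elim y (1 / max 1 (w a))
        (fun b => w (a - b) / (max 1 (w a) * max 1 (w b))))

/-- The topology on `P^1(L)` generated by the balls of the chordal metric. -/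
noncomputable def p1Top {L : Type} [Field L] (w : AbsoluteValue L ℝ) :
    TopologicalSpace (OnePoint L) :=
  TopologicalSpace.generateFrom
    {U | ∃ (x : OnePoint L) (ε : ℝ), 0 < ε ∧ U = {y | p1Dist w x y < ε}}

/-- The topology on `(P^1(L))^ι` induced by the chordal metric topology on each factor. -/
noncomputable def pnTop {L : Type} [Field L] (ι : Type) (w : AbsoluteValue L ℝ) :
    TopologicalSpace (ι → OnePoint L) :=
  @Pi.topologicalSpace ι (fun _ => OnePoint L) (fun _ => p1Top w)

/-- The closure of a set of points of `(P^1(L))^ι` in the topology induced by an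
absolute value on `L`. -/
noncomputable def adicClosure {L : Type} [Field L] {ι : Type} (w : AbsoluteValue L ℝ)
    (S : Set (ι → OnePoint L)) : Set (ι → OnePoint L) :=
  @closure _ (pnTop ι w) S

/-- Base change of a point of `P^1(K)` along a field embedding. -/
def mapPoint {K L : Type} [Field K] [Field L] (φ : K →+* L) :
    OnePoint K → OnePoint L :=
  OnePoint.map φ

/-- `K` is a number field, or a function field of characteristic zero over the ground
field `κ` (finitely generated of transcendence degree 1 over `κ`, with `κ` relatively
algebraically closed in `K`). -/
def NumberFieldOrFunctionFieldOver (K : Type) [Field K] (κ : Subfield K) : Prop :=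
  NumberField K ∨
    (CharZero K ∧
      (∃ t : K, Transcendental κ t ∧
        FiniteDimensional (IntermediateField.adjoin κ {t}) K) ∧
      (∀ x : K, IsAlgebraic κ x → x ∈ κ))

/-- The places of `K` relevant for the theorems: in the number field case all places are
allowed; in the function field case only places trivial on the ground field `κ`. -/
def PlaceK.IsPlaceOver {K : Type} [Field K] (κ : Subfield K) (w : PlaceK K) : Prop :=
  NumberField K ∨ (∀ c : K, c ∈ κ → c ≠ 0 → w.v c = 1)

open AlgebraicGeometry CategoryTheory

/-- The valuation (sub)ring of a field with a non-archimedean absolute value. -/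
def avSubring {L : Type} [Field L] (v : AbsoluteValue L ℝ)
    (hna : ∀ x y : L, v (x + y) ≤ max (v x) (v y)) : Subring L where
  carrier := {x | v x ≤ 1}
  mul_mem' := by
    intro a b ha hb
    simp only [Set.mem_setOf_eq, map_mul] at *
    nlinarith [v.nonneg a, v.nonneg b]
  one_mem' := by simp [Set.mem_setOf_eq]
  add_mem' := by
    intro a b ha hb
    simp only [Set.mem_setOf_eq] at *
    exact le_trans (hna a b) (max_le ha hb)
  zero_mem' := by simp [Set.mem_setOf_eq]
  neg_mem' := by
    intro a ha
    simpa only [Set.mem_setOf_eq, v.map_neg] using ha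

/-- The maximal ideal of the valuation ring of a non-archimedean absolute value. -/
def avMaxIdeal {L : Type} [Field L] (v : AbsoluteValue L ℝ)
    (hna : ∀ x y : L, v (x + y) ≤ max (v x) (v y)) : Ideal (avSubring v hna) where
  carrier := {x | v x.1 < 1}
  add_mem' := by
    intro a b ha hb
    simp only [Set.mem_setOf_eq] at *
    exact lt_of_le_of_lt (hna a.1 b.1) (max_lt ha hb)
  zero_mem' := by simp [Set.mem_setOf_eq]
  smul_mem' := by
    intro c x hx
    simp only [Set.mem_setOf_eq, smul_eq_mul] at *
    have h1 : v ((c * x : avSubring v hna) : L) = v c.1 * v x.1 := by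
      simp [map_mul]
    rw [h1]
    have hc2 : v c.1 ≤ 1 := c.2
    have hx0 : 0 ≤ v x.1 := v.nonneg x.1
    have hc0 : 0 ≤ v c.1 := v.nonneg c.1
    nlinarith

lemma avMaxIdeal_isPrime {L : Type} [Field L] (v : AbsoluteValue L ℝ)
    (hna : ∀ x y : L, v (x + y) ≤ max (v x) (v y)) : (avMaxIdeal v hna).IsPrime := by
  constructor
  · intro h
    have h1 : (1 : avSubring v hna) ∈ avMaxIdeal v hna := h ▸ Submodule.mem_top
    have : v (1 : L) < 1 := h1
    simp [v.map_one] at this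
  · intro x y hxy
    by_contra hc
    push_neg at hc
    obtain ⟨hx, hy⟩ := hc
    have hx' : v x.1 = 1 := le_antisymm x.2 (not_lt.mp hx)
    have hy' : v y.1 = 1 := le_antisymm y.2 (not_lt.mp hy)
    have : v ((x * y : avSubring v hna) : L) < 1 := hxy
    rw [show ((x * y : avSubring v hna) : L) = x.1 * y.1 from rfl, map_mul, hx', hy'] at this
    simp at this

/-- iterate of a scheme endomorphism -/
noncomputable def schemeIter {X : Scheme} (φ : X ⟶ X) : ℕ → (X ⟶ X)
  | 0 => 𝟙 X
  | k + 1 => schemeIter φ k ≫ φ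

/-- smooth at a point -/
def SmoothAtPt {X Y : Scheme} (f : X ⟶ Y) (x : X) : Prop :=
  ∃ U : X.Opens, x ∈ U ∧ IsSmooth (U.ι ≫ f)

def EtaleAtPt {X Y : Scheme} (f : X ⟶ Y) (x : X) : Prop :=
  ∃ U : X.Opens, x ∈ U ∧ IsEtale (U.ι ≫ f)

theorem exists_sub_map_mem_pow {A : Type*} [CommRing A] (F : A →+* A) (M : Ideal A)
    (hM : M.map F = M) (hF : ∀ a, ∃ b, a - F b ∈ M) (n : ℕ) :
    ∀ a, ∃ b, a - F b ∈ M ^ n := by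
  induction n with
  | zero => intro a; exact ⟨0, by simp⟩
  | succ n ih =>
    have key : ∀ y ∈ M ^ n, ∃ b, y - F b ∈ M ^ (n + 1) := by
      intro y hy
      rw [← hM, ← Ideal.map_pow] at hy
      induction hy using Submodule.span_induction with
      | mem y hy =>
        obtain ⟨b, -, rfl⟩ := hy
        exact ⟨b, by simp⟩
      | zero => exact ⟨0, by simp⟩
      | add y z _ _ hy hz =>
        obtain ⟨b, hb⟩ := hy
        obtain ⟨c, hc⟩ := hz
        refine ⟨b + c, ?_⟩
        have := add_mem hb hc
        rwa [show y - F b + (z - F c) = y + z - F (b + c) by rw [map_add]; ring] at this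
      | smul a y hy hb =>
        obtain ⟨b, hb⟩ := hb
        obtain ⟨c, hc⟩ := hF a
        refine ⟨c * b, ?_⟩
        change y ∈ Ideal.map F (M ^ n) at hy
        rw [Ideal.map_pow, hM] at hy
        have h1 : (a - F c) * y ∈ M ^ (n + 1) := by
          rw [pow_succ']
          exact Ideal.mul_mem_mul hc hy
        have := add_mem h1 (Ideal.mul_mem_left _ (F c) hb)
        rwa [show (a - F c) * y + F c * (y - F b) = a • y - F (c * b) by
          rw [map_mul, smul_eq_mul]; ring] at this
    intro a
    obtain ⟨b, hb⟩ := ih a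
    obtain ⟨c, hc⟩ := key _ hb
    exact ⟨b + c, by rwa [map_add, ← sub_sub]⟩

theorem exists_sub_pow_map_mem {A : Type*} [CommRing A] (F : A →+* A) (I : Ideal A)
    (hI : I ≤ I.comap F) (hF : ∀ a, ∃ b, a - F b ∈ I) (t : ℕ) :
    ∀ a, ∃ b, a - (F ^ t) b ∈ I := by
  induction t with
  | zero => intro a; exact ⟨a, by simp⟩
  | succ t ih =>
    intro a
    obtain ⟨b, hb⟩ := hF a
    obtain ⟨c, hc⟩ := ih b
    refine ⟨c, ?_⟩
    have := add_mem hb (hI hc)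
    rwa [map_sub, sub_add_sub_cancel, ← RingHom.comp_apply, ← RingHom.mul_def, ← pow_succ'] at this

/-- An endomorphism of a Noetherian ring that is surjective modulo an ideal `I` and preserves an
ideal `J ⊇ I` satisfies `F ⁻¹ J = J`. -/
theorem mem_of_pow_map_mem {A : Type*} [CommRing A] [IsNoetherianRing A] (F : A →+* A)
    (I J : Ideal A) (hIJ : I ≤ J) (hI : I ≤ I.comap F) (hJ : J ≤ J.comap F)
    (hF : ∀ a, ∃ b, a - F b ∈ I) (t : ℕ) (a : A) (ha : (F ^ t) a ∈ J) : a ∈ J := by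
  have hmono : Monotone fun k : ℕ ↦ J.comap (F ^ k) := by
    refine monotone_nat_of_le_succ fun k b hb ↦ ?_
    simp only [Ideal.mem_comap, pow_succ', RingHom.mul_def, RingHom.comp_apply] at hb ⊢
    exact hJ hb
  obtain ⟨k, hk⟩ := monotone_stabilizes_iff_noetherian.mpr ‹IsNoetherianRing A› ⟨_, hmono⟩
  have hIk : ∀ s, I ≤ I.comap (F ^ s) := by
    intro s
    induction s with
    | zero => intro b hb; simpa using hb
    | succ s ih =>
      intro b hb
      simp only [Ideal.mem_comap, pow_succ', RingHom.mul_def, RingHom.comp_apply] at hb ⊢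
      exact hI (ih hb)
  obtain ⟨b, hb⟩ := exists_sub_pow_map_mem F I hI hF k a
  have h1 : (F ^ (k + t)) b ∈ J := by
    have := sub_mem ha (hIJ (hIk t hb))
    rwa [map_sub, sub_sub_cancel, ← RingHom.comp_apply, ← RingHom.mul_def, ← pow_add,
      add_comm] at this
  have h2 : (F ^ k) b ∈ J := by
    have : b ∈ J.comap (F ^ (k + t)) := h1
    rw [show J.comap (F ^ (k + t)) = J.comap (F ^ k) from (hk (k + t) (by omega)).symm] at this
    exact this
  have := add_mem (hIJ hb) h2
  rwa [sub_add_cancel] at this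

theorem pow_le_comap_pow {A B : Type*} [CommRing A] [CommRing B] (f : A →+* B)
    {M : Ideal A} {m : Ideal B} (h : M ≤ m.comap f) (n : ℕ) : M ^ n ≤ (m ^ n).comap f :=
  (Ideal.pow_right_mono h n).trans (Ideal.le_comap_pow f n)

theorem le_comap_pow_of_iterate_sub_mem {A R : Type*} [CommRing A] [IsNoetherianRing A]
    [CommRing R] (F : A →+* A) (M J : Ideal A) (m : Ideal R) (hM : M.map F = M)
    (hF : ∀ a, ∃ b, a - F b ∈ M) (hJ : J ≤ J.comap F) (r θ : A →+* R)
    (hr : M ≤ m.comap r) (hθ : M ≤ m.comap θ) (hθJ : J ≤ RingHom.ker θ) (n t : ℕ)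
    (h : ∀ a, r ((F ^ t) a) - θ a ∈ m ^ n) : J ≤ (m ^ n).comap r := by
  have hMF : M ^ n ≤ (M ^ n).comap F := pow_le_comap_pow F (Ideal.map_le_iff_le_comap.mp hM.le) n
  have hFn := exists_sub_map_mem_pow F M hM hF n
  intro a ha
  obtain ⟨c, hc⟩ := exists_sub_pow_map_mem F (M ^ n) hMF hFn t a
  have hc' : c ∈ J ⊔ M ^ n := by
    refine mem_of_pow_map_mem F (M ^ n) (J ⊔ M ^ n) le_sup_right hMF ?_ hFn t c ?_
    · exact sup_le (hJ.trans (Ideal.comap_mono le_sup_left))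
        (hMF.trans (Ideal.comap_mono le_sup_right))
    · have := sub_mem (Ideal.mem_sup_left ha) (Ideal.mem_sup_right (S := J) hc)
      rwa [sub_sub_cancel] at this
  have hθc : θ c ∈ m ^ n := by
    have : J ⊔ M ^ n ≤ (m ^ n).comap θ := by
      refine sup_le (fun y hy ↦ ?_) (pow_le_comap_pow θ hθ n)
      rw [Ideal.mem_comap, RingHom.mem_ker.mp (hθJ hy)]
      exact zero_mem _
    exact this hc'
  have hr' : r (a - (F ^ t) c) ∈ m ^ n := pow_le_comap_pow r hr n hc
  have := add_mem (add_mem hr' (h c)) hθc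
  rw [map_sub] at this
  simpa using this

theorem eq_of_comp_eq {A R : Type*} [CommRing A] [CommRing R] [IsLocalRing R]
    [IsNoetherianRing R] (F : A →+* A) (M : Ideal A) (hM : M.map F = M)
    (hF : ∀ a, ∃ b, a - F b ∈ M) (r θ : A →+* R)
    (hr : M ≤ (IsLocalRing.maximalIdeal R).comap r)
    (hθ : M ≤ (IsLocalRing.maximalIdeal R).comap θ) (h : r.comp F = θ.comp F) : r = θ := by
  ext a
  rw [← sub_eq_zero, ← Ideal.mem_bot,
    ← Ideal.iInf_pow_eq_bot_of_isLocalRing _ (IsLocalRing.maximalIdeal.isMaximal R).ne_top,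
    Ideal.mem_iInf]
  intro n
  obtain ⟨b, hb⟩ := exists_sub_map_mem_pow F M hM hF n a
  have hr' : r (a - F b) ∈ IsLocalRing.maximalIdeal R ^ n := pow_le_comap_pow r hr n hb
  have := sub_mem hr' (pow_le_comap_pow θ hθ n hb)
  rwa [map_sub, map_sub, show r (F b) = θ (F b) from congr($h b), sub_sub_sub_cancel_right] at this

theorem AbsoluteValue.le_one_of_isIntegral {K : Type} {A : Type*} [Field K] [CommRing A]
    [Algebra A K] (v : AbsoluteValue K ℝ) (hv : ∀ x y : K, v (x + y) ≤ max (v x) (v y))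
    (hA : ∀ a : A, v (algebraMap A K a) ≤ 1) {x : K} (hx : IsIntegral A x) : v x ≤ 1 := by
  let V : ValuationSubring K :=
    { toSubring := avSubring v hv
      mem_or_inv_mem' := fun y ↦ by
        change v y ≤ 1 ∨ v y⁻¹ ≤ 1
        rw [map_inv₀]
        rcases le_total (v y) 1 with h | h
        · exact Or.inl h
        · exact Or.inr (inv_le_one_of_one_le₀ h) }
  have hx' : ((algebraMap V K).comp
      ((algebraMap A K).codRestrict V.toSubring fun a ↦ hA a)).IsIntegralElem x := hx
  obtain ⟨y, rfl⟩ := (IsIntegrallyClosed.isIntegral_iff (R := V)).mp hx'.of_comp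
  exact y.2

theorem AbsoluteValue.exists_uniformizer_of_isDedekindDomain {K : Type} {R : Type*} [Field K]
    [CommRing R] [IsDedekindDomain R] [Algebra R K] [IsFractionRing R K]
    (v : AbsoluteValue K ℝ) (hv : ∀ x y : K, v (x + y) ≤ max (v x) (v y))
    (hR : ∀ a : R, v (algebraMap R K a) ≤ 1) (hnt : ∃ x : K, x ≠ 0 ∧ v x ≠ 1) :
    ∃ π : K, π ≠ 0 ∧ v π < 1 ∧ ∀ x, v x < 1 → v x ≤ v π := by
  let P : Ideal R := (avMaxIdeal v hv).comap ((algebraMap R K).codRestrict (avSubring v hv) hR)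
  have hP : P.IsPrime :=
    have := avMaxIdeal_isPrime v hv
    Ideal.comap_isPrime _ _
  have memP : ∀ a : R, a ∈ P ↔ v (algebraMap R K a) < 1 := fun a ↦ Iff.rfl
  have notMemP : ∀ a : R, a ∉ P → v (algebraMap R K a) = 1 := fun a ha ↦
    le_antisymm (hR a) (not_lt.mp ha)
  have hP0 : P ≠ ⊥ := by
    intro h0
    obtain ⟨x, hx0, hx⟩ := hnt
    obtain ⟨a, b, hb, rfl⟩ := IsFractionRing.div_surjective (A := R) x
    have hb0 : b ≠ 0 := nonZeroDivisors.ne_zero hb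
    have ha0 : a ≠ 0 := by rintro rfl; simp at hx0
    apply hx
    rw [map_div₀, notMemP a (by simpa [h0] using ha0), notMemP b (by simpa [h0] using hb0), div_one]
  let p : IsDedekindDomain.HeightOneSpectrum R := ⟨P, hP, hP0⟩
  have le_one : ∀ x : K, p.valuation K x ≤ 1 → v x ≤ 1 := by
    intro x hx
    obtain ⟨b, a, hb⟩ := p.exists_primeCompl_mul_eq_of_integer x hx
    have h1 := congr(v $hb)
    rw [map_mul, notMemP _ a.2, mul_one] at h1
    exact h1 ▸ hR _
  obtain ⟨π, hπ⟩ := p.valuation_exists_uniformizer K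
  have hπ0 : π ≠ 0 := by
    rintro rfl
    rw [map_zero] at hπ
    exact WithZero.exp_ne_zero hπ.symm
  refine ⟨π, hπ0, ?_, ?_⟩
  · obtain ⟨b, a, hb⟩ := p.exists_primeCompl_mul_eq_of_integer π
      (by rw [hπ, ← WithZero.exp_zero, WithZero.exp_le_exp]; omega)
    have h1 := congr(v $hb)
    rw [map_mul, notMemP _ a.2, mul_one] at h1
    rw [h1, ← memP]
    refine (p.valuation_lt_one_iff_mem (K := K) b).mp ?_
    change p.valuation K (algebraMap R K b) < 1
    rw [← hb, map_mul, hπ]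
    refine (mul_le_of_le_one_right' (p.valuation_le_one _)).trans_lt ?_
    rw [← WithZero.exp_zero, WithZero.exp_lt_exp]
    omega
  · intro x hx
    rcases eq_or_ne x 0 with rfl | hx0
    · simp
    have hlt : p.valuation K x < 1 := by
      by_contra! hge
      have := le_one x⁻¹ (by rw [map_inv₀]; exact inv_le_one_of_one_le₀ hge)
      rw [map_inv₀] at this
      exact absurd ((one_lt_inv₀ (v.pos hx0)).mpr hx) this.not_gt
    have hle : p.valuation K x ≤ p.valuation K π := by
      rw [hπ]
      have hne : p.valuation K x ≠ 0 := by simpa using hx0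
      rw [← WithZero.exp_log hne, WithZero.exp_le_exp]
      rw [← WithZero.exp_log hne, ← WithZero.exp_zero, WithZero.exp_lt_exp] at hlt
      omega
    have := le_one (x / π) (by
      rw [map_div₀]
      exact div_le_one_of_le₀ hle zero_le)
    rw [map_div₀, div_le_one (v.pos hπ0)] at this
    exact this

theorem AbsoluteValue.exists_uniformizer_of_numberField {K : Type} [Field K] [NumberField K]
    (v : AbsoluteValue K ℝ) (hv : ∀ x y : K, v (x + y) ≤ max (v x) (v y))
    (hnt : ∃ x : K, x ≠ 0 ∧ v x ≠ 1) :
    ∃ π : K, π ≠ 0 ∧ v π < 1 ∧ ∀ x, v x < 1 → v x ≤ v π := by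
  refine v.exists_uniformizer_of_isDedekindDomain (R := NumberField.RingOfIntegers K) hv
    (fun a ↦ v.le_one_of_isIntegral (A := ℤ) hv (fun n ↦ ?_)
      (NumberField.RingOfIntegers.isIntegral_coe a)) hnt
  rw [eq_intCast]
  exact intCast_mem (avSubring v hv) n

theorem AbsoluteValue.exists_uniformizer_of_finiteDimensional_adjoin {K : Type} [Field K]
    [CharZero K] {κ : Subfield K} {t : K} (ht : Transcendental κ t)
    (hfin : FiniteDimensional (IntermediateField.adjoin κ {t}) K)
    (v : AbsoluteValue K ℝ) (hv : ∀ x y : K, v (x + y) ≤ max (v x) (v y))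
    (hκ : ∀ c ∈ κ, c ≠ 0 → v c = 1) (htv : v t ≤ 1)
    (hnt : ∃ x : K, x ≠ 0 ∧ v x ≠ 1) :
    ∃ π : K, π ≠ 0 ∧ v π < 1 ∧ ∀ x, v x < 1 → v x ≤ v π := by
  have hPID : IsPrincipalIdealRing (Algebra.adjoin κ {t}) :=
    IsPrincipalIdealRing.of_surjective
      (Polynomial.algEquivOfTranscendental κ t ht).toRingEquiv.toRingHom
      (Polynomial.algEquivOfTranscendental κ t ht).surjective
  have hA : ∀ a : Algebra.adjoin κ {t}, v (algebraMap (Algebra.adjoin κ {t}) K a) ≤ 1 := by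
    rintro ⟨a, ha⟩
    change a ∈ avSubring v hv
    induction ha using Algebra.adjoin_induction with
    | mem x hx => exact (Set.mem_singleton_iff.mp hx) ▸ htv
    | algebraMap c =>
      change v (c : K) ≤ 1
      rcases eq_or_ne (c : K) 0 with h | h
      · simp [h]
      · exact (hκ c c.2 h).le
    | add x y _ _ hx hy => exact add_mem hx hy
    | mul x y _ _ hx hy => exact mul_mem hx hy
  open scoped IntermediateField.algebraAdjoinAdjoin in
  have hD : IsDedekindDomain (integralClosure (Algebra.adjoin κ {t}) K) :=
    integralClosure.isDedekindDomain (Algebra.adjoin κ {t}) (IntermediateField.adjoin κ {t}) K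
  open scoped IntermediateField.algebraAdjoinAdjoin in
  have hFr : IsFractionRing (integralClosure (Algebra.adjoin κ {t}) K) K :=
    integralClosure.isFractionRing_of_finite_extension (A := Algebra.adjoin κ {t})
      (IntermediateField.adjoin κ {t}) K
  exact v.exists_uniformizer_of_isDedekindDomain
    (R := integralClosure (Algebra.adjoin κ {t}) K) hv
    (fun a ↦ v.le_one_of_isIntegral hv hA a.2) hnt

theorem PlaceK.exists_uniformizer {K : Type} [Field K] {κ : Subfield K}
    (hK : NumberFieldOrFunctionFieldOver K κ) (w : PlaceK K) (hw : w.IsNonarch)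
    (hwκ : w.IsPlaceOver κ) : ∃ π : K, π ≠ 0 ∧ w.v π < 1 ∧ ∀ x, w.v x < 1 → w.v x ≤ w.v π := by
  by_cases hN : NumberField K
  · exact w.v.exists_uniformizer_of_numberField hw w.nontrivial
  obtain ⟨_, ⟨t, ht, hfin⟩, -⟩ := hK.resolve_left hN
  have hκ := hwκ.resolve_left hN
  rcases le_or_gt (w.v t) 1 with h | h
  · exact w.v.exists_uniformizer_of_finiteDimensional_adjoin ht hfin hw hκ h w.nontrivial
  · have hadj : IntermediateField.adjoin κ {t⁻¹} = IntermediateField.adjoin κ {t} := by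
      apply le_antisymm
      · rw [IntermediateField.adjoin_simple_le_iff]
        exact inv_mem (IntermediateField.mem_adjoin_simple_self κ t)
      · rw [IntermediateField.adjoin_simple_le_iff]
        simpa using inv_mem (IntermediateField.mem_adjoin_simple_self κ t⁻¹)
    refine w.v.exists_uniformizer_of_finiteDimensional_adjoin (t := t⁻¹)
      (fun halg ↦ ht (by simpa using halg.inv)) (hadj ▸ hfin) hw hκ ?_ w.nontrivial
    rw [map_inv₀]
    exact inv_le_one_of_one_le₀ h.le

theorem CompletionOf.exists_uniformizer {K : Type} [Field K] {w : PlaceK K} (C : CompletionOf w)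
    (hna : ∀ x y : C.carrier, C.absv (x + y) ≤ max (C.absv x) (C.absv y))
    (h : ∃ π : K, π ≠ 0 ∧ w.v π < 1 ∧ ∀ x, w.v x < 1 → w.v x ≤ w.v π) :
    ∃ π : C.carrier, π ≠ 0 ∧ C.absv π < 1 ∧ ∀ x, C.absv x < 1 → C.absv x ≤ C.absv π := by
  obtain ⟨π, hπ0, hπ1, hπ⟩ := h
  refine ⟨C.emb π, by simpa using hπ0, by rwa [C.compat], fun x hx ↦ ?_⟩
  obtain ⟨y, hy⟩ := C.dense x _ (w.v.pos hπ0)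
  have hyx : w.v y < 1 := by
    rw [← C.compat]
    calc C.absv (C.emb y) = C.absv (x + -(x - C.emb y)) := by congr 1; ring
      _ ≤ max (C.absv x) (C.absv (-(x - C.emb y))) := hna _ _
      _ < 1 := max_lt hx (by rw [AbsoluteValue.map_neg]; exact hy.trans hπ1)
  calc C.absv x = C.absv ((x - C.emb y) + C.emb y) := by congr 1; ring
    _ ≤ max (C.absv (x - C.emb y)) (C.absv (C.emb y)) := hna _ _
    _ ≤ C.absv (C.emb π) := by
      rw [C.compat, C.compat]
      exact max_le hy.le (hπ y hyx)

theorem isUnit_avSubring_iff {L : Type} [Field L] (v : AbsoluteValue L ℝ)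
    (hna : ∀ x y : L, v (x + y) ≤ max (v x) (v y)) (x : avSubring v hna) :
    IsUnit x ↔ v x = 1 := by
  constructor
  · rintro ⟨u, rfl⟩
    refine le_antisymm u.1.2 ?_
    have h : v (u.1 : L) * v ((u⁻¹).1 : L) = 1 := by
      rw [← map_mul, ← Subring.coe_mul, Units.mul_inv, Subring.coe_one, map_one]
    have h2 : v ((u⁻¹).1 : L) ≤ 1 := (u⁻¹).1.2
    nlinarith [v.nonneg (u.1 : L)]
  · intro h
    have hx : (x : L) ≠ 0 := by
      rintro h0
      simp [h0] at h
    refine IsUnit.of_mul_eq_one ⟨(x : L)⁻¹, ?_⟩ (Subtype.ext (mul_inv_cancel₀ hx))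
    change v (x : L)⁻¹ ≤ 1
    rw [map_inv₀, h, inv_one]

theorem isDiscreteValuationRing_avSubring {L : Type} [Field L] (v : AbsoluteValue L ℝ)
    (hna : ∀ x y : L, v (x + y) ≤ max (v x) (v y))
    (h : ∃ π : L, π ≠ 0 ∧ v π < 1 ∧ ∀ x, v x < 1 → v x ≤ v π) :
    IsDiscreteValuationRing (avSubring v hna) := by
  obtain ⟨π, hπ0, hπ1, hπ⟩ := h
  have hvπ := v.pos hπ0
  let ϖ : avSubring v hna := ⟨π, hπ1.le⟩
  apply IsDiscreteValuationRing.ofHasUnitMulPowIrreducibleFactorization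
  refine ⟨ϖ, ⟨?_, ?_⟩, ?_⟩
  · rw [isUnit_avSubring_iff]
    exact hπ1.ne
  · intro a b hab
    simp only [isUnit_avSubring_iff]
    by_contra! hne
    have ha := hπ _ (lt_of_le_of_ne a.2 hne.1)
    have hb := lt_of_le_of_ne b.2 hne.2
    have hab' : v π = v a * v b := by
      rw [← map_mul, ← Subring.coe_mul, ← hab]
    have := v.nonneg (b : L)
    nlinarith
  · intro x hx
    have hx0 : (x : L) ≠ 0 := by simpa using hx
    have hvx := v.pos hx0
    obtain ⟨n, hn, hn'⟩ := exists_nat_pow_near_of_lt_one hvx x.2 hvπ hπ1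
    have hvn : 0 < v π ^ n := pow_pos hvπ n
    have h1 : v (x / π ^ n : L) = 1 := by
      rw [map_div₀, map_pow]
      refine le_antisymm ((div_le_one hvn).mpr hn') ?_
      by_contra! hlt
      have := hπ (x / π ^ n) (by rwa [map_div₀, map_pow])
      rw [map_div₀, map_pow, div_le_iff₀ hvn, ← pow_succ'] at this
      exact hn.not_ge this
    obtain ⟨u, hu⟩ := (isUnit_avSubring_iff v hna ⟨x / π ^ n, h1.le⟩).mpr h1
    refine ⟨n, u, Subtype.ext ?_⟩
    rw [hu]
    change π ^ n * (x / π ^ n) = x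
    field_simp

theorem avMaxIdeal_eq_maximalIdeal {L : Type} [Field L] (v : AbsoluteValue L ℝ)
    (hna : ∀ x y : L, v (x + y) ≤ max (v x) (v y)) [IsLocalRing (avSubring v hna)] :
    avMaxIdeal v hna = IsLocalRing.maximalIdeal (avSubring v hna) := by
  ext x
  rw [IsLocalRing.mem_maximalIdeal, mem_nonunits_iff, isUnit_avSubring_iff]
  exact ⟨fun h ↦ (show v x < 1 from h).ne, fun h ↦ lt_of_le_of_ne x.2 h⟩

theorem schemeIter_succ {X : Scheme} (φ : X ⟶ X) (k : ℕ) :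
    schemeIter φ (k + 1) = schemeIter φ k ≫ φ := rfl

theorem schemeIter_add {X : Scheme} (φ : X ⟶ X) (a b : ℕ) :
    schemeIter φ (a + b) = schemeIter φ a ≫ schemeIter φ b := by
  induction b with
  | zero => exact (Category.comp_id _).symm
  | succ b ih => rw [← add_assoc, schemeIter_succ, ih, schemeIter_succ, Category.assoc]

theorem schemeIter_mul {X : Scheme} (φ : X ⟶ X) (a b : ℕ) :
    schemeIter φ (a * b) = schemeIter (schemeIter φ a) b := by
  induction b with
  | zero => rfl
  | succ b ih => rw [mul_add_one, schemeIter_add, ih, schemeIter_succ]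

theorem schemeIter_comp_of_comp_eq {X S : Scheme} {φ : X ⟶ X} {f : X ⟶ S} (h : φ ≫ f = f)
    (k : ℕ) : schemeIter φ k ≫ f = f := by
  induction k with
  | zero => exact Category.id_comp _
  | succ k ih => rw [schemeIter_succ, Category.assoc, h, ih]

theorem comp_schemeIter_of_semiconj {Y X : Scheme} {g : Y ⟶ X} {ψ : Y ⟶ Y} {φ : X ⟶ X}
    (h : g ≫ φ = ψ ≫ g) (k : ℕ) : g ≫ schemeIter φ k = schemeIter ψ k ≫ g := by
  induction k with
  | zero => exact (Category.comp_id _).trans (Category.id_comp _).symm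
  | succ k ih =>
    rw [schemeIter_succ, schemeIter_succ, ← Category.assoc, ih, Category.assoc, h, Category.assoc]

theorem schemeIter_add_apply {X : Scheme} (φ : X ⟶ X) (a b : ℕ) (x : X) :
    schemeIter φ (a + b) x = schemeIter φ b (schemeIter φ a x) := by
  rw [schemeIter_add, Scheme.Hom.comp_apply]

theorem schemeIter_mul_apply_of_fixed {X : Scheme} (φ : X ⟶ X) {a : ℕ} {x : X}
    (h : schemeIter φ a x = x) (b : ℕ) : schemeIter φ (a * b) x = x := by
  induction b with
  | zero => rfl
  | succ b ih => rw [mul_add_one, schemeIter_add_apply, ih, h]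

theorem map_stalkMap_comp {X Y W : Scheme} (f : X ⟶ Y) (g : Y ⟶ W) (x : X)
    (I : Ideal (W.presheaf.stalk ((f ≫ g) x))) :
    I.map ((f ≫ g).stalkMap x).hom =
      Ideal.map (f.stalkMap x).hom (Ideal.map (g.stalkMap (f x)).hom I) := by
  have h : ((f ≫ g).stalkMap x).hom = (f.stalkMap x).hom.comp (g.stalkMap (f x)).hom :=
    congrArg CommRingCat.Hom.hom (Scheme.Hom.stalkMap_comp f g x)
  rw [h]
  exact (Ideal.map_map _ _).symm

open IsLocalRing in
theorem EtaleAtPt.map_maximalIdeal_stalkMap {X Y : Scheme} {f : X ⟶ Y} {x : X}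
    (h : EtaleAtPt f x) :
    (maximalIdeal (Y.presheaf.stalk (f x))).map (f.stalkMap x).hom =
      maximalIdeal (X.presheaf.stalk x) := by
  obtain ⟨U, hxU, hU⟩ := h
  have : Etale (U.ι ≫ f) := hU
  obtain ⟨x, rfl⟩ : ∃ y : U.toScheme, U.ι y = x := ⟨⟨x, hxU⟩, rfl⟩
  have key : (maximalIdeal (Y.presheaf.stalk ((U.ι ≫ f) x))).map ((U.ι ≫ f).stalkMap x).hom =
      maximalIdeal (U.toScheme.presheaf.stalk x) := by
    have h1 := LocallyOfFiniteType.stalkMap (U.ι ≫ f) x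
    have h2 := FormallyUnramified.stalkMap (U.ι ≫ f) x
    have h3 : IsLocalHom ((U.ι ≫ f).stalkMap x).hom := inferInstance
    algebraize [((U.ι ≫ f).stalkMap x).hom]
    exact Algebra.FormallyUnramified.map_maximalIdeal
  rw [map_stalkMap_comp] at key
  have hu : Function.Bijective (U.ι.stalkMap x).hom :=
    ConcreteCategory.bijective_of_isIso (U.ι.stalkMap x)
  have h4 : (maximalIdeal (U.toScheme.presheaf.stalk x)).comap (U.ι.stalkMap x).hom =
      maximalIdeal (X.presheaf.stalk (U.ι x)) :=
    maximalIdeal_comap _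
  rw [← h4, ← key]
  exact (Ideal.comap_map_of_bijective _ hu).symm

open IsLocalRing in
theorem map_maximalIdeal_stalkMap_schemeIter {X : Scheme} {φ : X ⟶ X} {x : X}
    (h : ∀ k, EtaleAtPt φ (schemeIter φ k x)) (k : ℕ) :
    (maximalIdeal (X.presheaf.stalk (schemeIter φ k x))).map ((schemeIter φ k).stalkMap x).hom =
      maximalIdeal (X.presheaf.stalk x) := by
  induction k with
  | zero =>
    change (maximalIdeal (X.presheaf.stalk ((𝟙 X : X ⟶ X) x))).map
      ((𝟙 X : X ⟶ X).stalkMap x).hom = _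
    rw [Scheme.Hom.stalkMap_id]
    exact Ideal.map_id _
  | succ k ih =>
    change (maximalIdeal (X.presheaf.stalk ((schemeIter φ k ≫ φ) x))).map
      ((schemeIter φ k ≫ φ).stalkMap x).hom = _
    rw [map_stalkMap_comp, ← ih]
    exact congrArg _ (h k).map_maximalIdeal_stalkMap

open IsLocalRing in
theorem exists_stalk_end_of_fixed {X : Scheme} {f : X ⟶ X} {x : X} (hx : f x = x)
    (h : (maximalIdeal (X.presheaf.stalk (f x))).map (f.stalkMap x).hom =
      maximalIdeal (X.presheaf.stalk x)) :
    ∃ F : X.presheaf.stalk x ⟶ X.presheaf.stalk x,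
      Spec.map F ≫ X.fromSpecStalk x = X.fromSpecStalk x ≫ f ∧
      (maximalIdeal (X.presheaf.stalk x)).map F.hom = maximalIdeal (X.presheaf.stalk x) := by
  suffices ∀ y (hy : f x = y), ∃ F : X.presheaf.stalk y ⟶ X.presheaf.stalk x,
      Spec.map F ≫ X.fromSpecStalk y = X.fromSpecStalk x ≫ f ∧
      (maximalIdeal (X.presheaf.stalk y)).map F.hom = maximalIdeal (X.presheaf.stalk x) from
    this x hx
  rintro _ rfl
  exact ⟨f.stalkMap x, Scheme.SpecMap_stalkMap_fromSpecStalk f, h⟩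

theorem exists_spec_map_fromSpecStalk_eq {X : Scheme} {R : CommRingCat} [IsLocalRing R]
    (g : Spec R ⟶ X) {x : X} (hx : g (IsLocalRing.closedPoint R) = x) :
    ∃ r : X.presheaf.stalk x ⟶ R, IsLocalHom r.hom ∧ Spec.map r ≫ X.fromSpecStalk x = g := by
  subst hx
  exact ⟨Scheme.stalkClosedPointTo g, inferInstance, Scheme.Spec_stalkClosedPointTo_fromSpecStalk g⟩

/-- A closed subscheme is cut out on the local scheme of a point by an ideal. -/
theorem exists_ideal_factors_iff {X Z : Scheme} (ι : Z ⟶ X) [IsClosedImmersion ι]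
    {A : CommRingCat} (j : Spec A ⟶ X) :
    ∃ J : Ideal A, ∀ (B : CommRingCat) (g : A ⟶ B),
      (∃ s, s ≫ ι = Spec.map g ≫ j) ↔ J ≤ RingHom.ker g.hom := by
  obtain ⟨J, e, he⟩ := IsClosedImmersion.Spec_iff.mp
    (inferInstance : IsClosedImmersion (Limits.pullback.snd ι j))
  refine ⟨J, fun B g ↦ ⟨?_, fun h ↦ ?_⟩⟩
  · rintro ⟨s, hs⟩
    have h1 := Limits.pullback.lift_snd s (Spec.map g) hs
    rw [he, ← Category.assoc] at h1
    obtain ⟨u, hu⟩ := Spec.map_surjective (Limits.pullback.lift s (Spec.map g) hs ≫ e.hom)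
    rw [← hu, ← Spec.map_comp] at h1
    have h2 := Spec.map_injective h1
    intro a ha
    rw [RingHom.mem_ker, ← h2]
    simp [Ideal.Quotient.eq_zero_iff_mem.mpr ha]
  · let u : CommRingCat.of (A ⧸ J) ⟶ B := CommRingCat.ofHom (Ideal.Quotient.lift J g.hom h)
    have hu : CommRingCat.ofHom (Ideal.Quotient.mk J) ≫ u = g := by
      ext a
      exact Ideal.Quotient.lift_mk J g.hom h
    refine ⟨Spec.map u ≫ e.inv ≫ Limits.pullback.fst ι j, ?_⟩
    rw [Category.assoc, Category.assoc, Limits.pullback.condition, he, Category.assoc,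
      e.inv_hom_id_assoc, ← Spec.map_comp_assoc, hu]

open IsLocalRing in
theorem mem_maximalIdeal_of_map_eq_zero {A R : Type*} [CommRing A] [IsLocalRing A]
    [CommRing R] [Nontrivial R] (θ : A →+* R) {a : A} (ha : θ a = 0) : a ∈ maximalIdeal A :=
  (mem_maximalIdeal a).mpr fun h ↦ not_isUnit_zero (ha ▸ h.map θ)

theorem spec_map_pow_fromSpecStalk {X : Scheme} {f : X ⟶ X} {A : CommRingCat} {j : Spec A ⟶ X}
    {F : A ⟶ A} (h : Spec.map F ≫ j = j ≫ f) (t : ℕ) :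
    Spec.map (CommRingCat.ofHom (F.hom ^ t)) ≫ j = j ≫ schemeIter f t := by
  induction t with
  | zero =>
    rw [pow_zero]
    exact (congrArg (· ≫ j) (Spec.map_id A)).trans
      ((Category.id_comp j).trans (Category.comp_id j).symm)
  | succ t ih =>
    have h1 : CommRingCat.ofHom (F.hom ^ (t + 1)) = F ≫ CommRingCat.ofHom (F.hom ^ t) := by
      ext a
      rw [pow_succ]
      rfl
    rw [h1, Spec.map_comp, Category.assoc, h, ← Category.assoc, ih, Category.assoc, schemeIter_succ]

open IsLocalRing in
/-- The local form at a fixed closed point of an iterate of an endomorphism which is étale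
along the orbit of that point. -/
theorem exists_stalk_end_of_etale {R : Type} [CommRing R] [IsLocalRing R] {X : Scheme}
    {sX : X ⟶ Spec (CommRingCat.of R)} {φ : X ⟶ X} (hφ : φ ≫ sX = sX) {x : X}
    (het : ∀ k, EtaleAtPt φ (schemeIter φ k x)) {L : ℕ} (hL : schemeIter φ L x = x)
    {q : Spec (CommRingCat.of R) ⟶ X} (hq : q ≫ sX = 𝟙 _) (hqx : q (closedPoint R) = x) :
    ∃ F : X.presheaf.stalk x ⟶ X.presheaf.stalk x,
      Spec.map F ≫ X.fromSpecStalk x = X.fromSpecStalk x ≫ schemeIter φ L ∧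
      (maximalIdeal (X.presheaf.stalk x)).map F.hom = maximalIdeal (X.presheaf.stalk x) ∧
      ∀ a, ∃ b, a - F.hom b ∈ maximalIdeal (X.presheaf.stalk x) := by
  obtain ⟨F, hF, hM⟩ := exists_stalk_end_of_fixed hL (map_maximalIdeal_stalkMap_schemeIter het L)
  refine ⟨F, hF, hM, fun a ↦ ?_⟩
  obtain ⟨θ, -, hθ⟩ := exists_spec_map_fromSpecStalk_eq q hqx
  obtain ⟨s, hs⟩ := Spec.map_surjective (X.fromSpecStalk x ≫ sX)
  have hsθ : s ≫ θ = 𝟙 _ := by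
    apply Spec.map_injective
    rw [Spec.map_comp, hs, ← Category.assoc, hθ, hq, Spec.map_id]
  have hsF : s ≫ F = s := by
    apply Spec.map_injective
    rw [Spec.map_comp, hs, ← Category.assoc, hF, Category.assoc, schemeIter_comp_of_comp_eq hφ]
  have hsθ' (c : R) : θ.hom (s.hom c) = c := congr($(hsθ).hom c)
  have hsF' (c : R) : F.hom (s.hom c) = s.hom c := congr($(hsF).hom c)
  refine ⟨s.hom (θ.hom a), mem_maximalIdeal_of_map_eq_zero θ.hom ?_⟩
  rw [hsF', map_sub, hsθ', sub_self]

/-- Two morphisms from an affine scheme agree modulo an ideal. -/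
def CongrMod {R : Type} [CommRing R] {X : Scheme} (I : Ideal R)
    (g h : Spec (CommRingCat.of R) ⟶ X) : Prop :=
  Spec.map (CommRingCat.ofHom (Ideal.Quotient.mk I)) ≫ g =
    Spec.map (CommRingCat.ofHom (Ideal.Quotient.mk I)) ≫ h

theorem CongrMod.mono {R : Type} [CommRing R] {X : Scheme} {I I' : Ideal R} (hI : I ≤ I')
    {g h : Spec (CommRingCat.of R) ⟶ X} (hgh : CongrMod I g h) : CongrMod I' g h := by
  have h1 : CommRingCat.ofHom (Ideal.Quotient.mk I') =
      CommRingCat.ofHom (Ideal.Quotient.mk I) ≫ CommRingCat.ofHom (Ideal.Quotient.factor hI) := by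
    ext a
    exact (Ideal.Quotient.factor_mk hI a).symm
  unfold CongrMod at *
  rw [h1, Spec.map_comp, Category.assoc, Category.assoc, hgh]

theorem CongrMod.apply_closedPoint {R : Type} [CommRing R] [IsLocalRing R] {X : Scheme}
    {I : Ideal R} (hI : I ≤ IsLocalRing.maximalIdeal R) {g h : Spec (CommRingCat.of R) ⟶ X}
    (hgh : CongrMod I g h) : g (IsLocalRing.closedPoint R) = h (IsLocalRing.closedPoint R) := by
  obtain ⟨y, hy⟩ : ∃ y : Spec (CommRingCat.of (R ⧸ I)),
      Spec.map (CommRingCat.ofHom (Ideal.Quotient.mk I)) y = IsLocalRing.closedPoint R := by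
    have h1 : IsLocalRing.closedPoint R ∈
        Set.range (PrimeSpectrum.comap (Ideal.Quotient.mk I)) := by
      rw [range_comap_of_surjective _ _ Ideal.Quotient.mk_surjective, Ideal.mk_ker]
      exact hI
    exact h1
  rw [← hy, ← Scheme.Hom.comp_apply, ← Scheme.Hom.comp_apply]
  exact congr($hgh y)

theorem congrMod_spec_map_comp_iff {R : Type} [CommRing R] {X : Scheme} {A : CommRingCat}
    {j : Spec A ⟶ X} [Mono j] {I : Ideal R} {r θ : A ⟶ CommRingCat.of R} :
    CongrMod I (Spec.map r ≫ j) (Spec.map θ ≫ j) ↔ ∀ a, r.hom a - θ.hom a ∈ I := by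
  unfold CongrMod
  rw [← Spec.map_comp_assoc, ← Spec.map_comp_assoc, cancel_mono, Spec.map_inj]
  constructor
  · intro h a
    exact Ideal.Quotient.eq.mp congr($(h).hom a)
  · intro h
    ext a
    exact Ideal.Quotient.eq.mpr (h a)

open IsLocalRing in
theorem eq_of_forall_congrMod {R : Type} [CommRing R] [IsLocalRing R] [IsNoetherianRing R]
    {X : Scheme} {g h : Spec (CommRingCat.of R) ⟶ X}
    (hgh : ∀ n : ℕ, CongrMod (maximalIdeal R ^ n) g h) : g = h := by
  obtain ⟨r, -, hr⟩ := exists_spec_map_fromSpecStalk_eq g rfl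
  obtain ⟨θ, -, hθ⟩ := exists_spec_map_fromSpecStalk_eq h
    ((hgh 1).apply_closedPoint (pow_one _).le).symm
  rw [← hr, ← hθ] at hgh ⊢
  congr 2
  ext a
  rw [← sub_eq_zero, ← Ideal.mem_bot,
    ← Ideal.iInf_pow_eq_bot_of_isLocalRing _ (maximalIdeal.isMaximal R).ne_top, Ideal.mem_iInf]
  exact fun n ↦ congrMod_spec_map_comp_iff.mp (hgh n) a

open IsLocalRing in
theorem eq_of_comp_schemeIter_eq {R : Type} [CommRing R] [IsLocalRing R] [IsNoetherianRing R]
    {X : Scheme} {sX : X ⟶ Spec (CommRingCat.of R)} {φ : X ⟶ X} (hφ : φ ≫ sX = sX) {x : X}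
    (het : ∀ k, EtaleAtPt φ (schemeIter φ k x)) {L : ℕ} (hL : schemeIter φ L x = x)
    {g q : Spec (CommRingCat.of R) ⟶ X} (hgx : g (closedPoint R) = x)
    (hq : q ≫ sX = 𝟙 _) (hqx : q (closedPoint R) = x)
    (h : g ≫ schemeIter φ L = q ≫ schemeIter φ L) : g = q := by
  obtain ⟨F, hF, hM, hFM⟩ := exists_stalk_end_of_etale hφ het hL hq hqx
  obtain ⟨r, hr', hr⟩ := exists_spec_map_fromSpecStalk_eq g hgx
  obtain ⟨θ, hθ', hθ⟩ := exists_spec_map_fromSpecStalk_eq q hqx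
  have h1 : F ≫ r = F ≫ θ := by
    apply Spec.map_injective
    rw [← cancel_mono (X.fromSpecStalk x), Spec.map_comp, Spec.map_comp, Category.assoc,
      Category.assoc, hF, ← Category.assoc, ← Category.assoc, hr, hθ, h]
  rw [← hr, ← hθ]
  congr 2
  ext1
  exact eq_of_comp_eq F.hom _ hM hFM r.hom θ.hom (((local_hom_TFAE r.hom).out 0 3).mp hr')
    (((local_hom_TFAE θ.hom).out 0 3).mp hθ') congr($(h1).hom)

theorem le_comap_of_factors_iff {X Z : Scheme} {ι : Z ⟶ X} {A : CommRingCat} {j : Spec A ⟶ X}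
    {J : Ideal A} (hJ : ∀ (B : CommRingCat) (g : A ⟶ B),
      (∃ s, s ≫ ι = Spec.map g ≫ j) ↔ J ≤ RingHom.ker g.hom)
    {F : A ⟶ A} {f : X ⟶ X} (hF : Spec.map F ≫ j = j ≫ f) {ψ : Z ⟶ Z} (hψ : ι ≫ f = ψ ≫ ι) :
    J ≤ J.comap F.hom := by
  obtain ⟨s, hs⟩ := (hJ (CommRingCat.of (A ⧸ J)) (CommRingCat.ofHom (Ideal.Quotient.mk J))).mpr
    Ideal.mk_ker.ge
  have h := (hJ _ (F ≫ CommRingCat.ofHom (Ideal.Quotient.mk J))).mp ⟨s ≫ ψ, by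
    rw [Spec.map_comp, Category.assoc, Category.assoc, hF, ← hψ, ← Category.assoc, hs,
      Category.assoc]⟩
  intro a ha
  have h1 : Ideal.Quotient.mk J (F.hom a) = 0 := h ha
  exact Ideal.mem_comap.mpr (Ideal.Quotient.eq_zero_iff_mem.mp h1)

open IsLocalRing in
/-- If the orbit of a section under an iterate of `φ` fixing its closed point accumulates at a
section of an invariant closed subscheme, then the section itself lies in that subscheme. -/
theorem exists_comp_eq_of_orbit_accumulates {R : Type} [CommRing R] [IsLocalRing R]
    [IsNoetherianRing R] {X Z : Scheme} (sX : X ⟶ Spec (CommRingCat.of R)) [LocallyOfFiniteType sX]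
    {φ : X ⟶ X} (hφ : φ ≫ sX = sX) {x : X} (het : ∀ k, EtaleAtPt φ (schemeIter φ k x)) {L : ℕ}
    (hL : schemeIter φ L x = x) (ι : Z ⟶ X) [IsClosedImmersion ι] {ψ : Z ⟶ Z}
    (hψ : ι ≫ schemeIter φ L = ψ ≫ ι) {g q : Spec (CommRingCat.of R) ⟶ X}
    (hgx : g (closedPoint R) = x) (hq : q ≫ sX = 𝟙 _) (hqx : q (closedPoint R) = x)
    (hqι : ∃ s, s ≫ ι = q)
    (h : ∀ n, ∃ t, CongrMod (maximalIdeal R ^ n) (g ≫ schemeIter φ (L * t)) q) :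
    ∃ s, s ≫ ι = g := by
  have : IsLocallyNoetherian X := LocallyOfFiniteType.isLocallyNoetherian sX
  have : IsNoetherianRing (X.presheaf.stalk x) := inferInstance
  obtain ⟨F, hF, hM, hFM⟩ := exists_stalk_end_of_etale hφ het hL hq hqx
  obtain ⟨r, hr', hr⟩ := exists_spec_map_fromSpecStalk_eq g hgx
  obtain ⟨θ, hθ', hθ⟩ := exists_spec_map_fromSpecStalk_eq q hqx
  obtain ⟨J, hJ⟩ := exists_ideal_factors_iff ι (X.fromSpecStalk x)
  have hJF := le_comap_of_factors_iff hJ hF hψ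
  rw [← hθ] at hqι
  rw [← hr]
  refine (hJ _ r).mpr fun a ha ↦ ?_
  rw [RingHom.mem_ker, ← Ideal.mem_bot,
    ← Ideal.iInf_pow_eq_bot_of_isLocalRing _ (maximalIdeal.isMaximal R).ne_top, Ideal.mem_iInf]
  intro n
  obtain ⟨t, ht⟩ := h n
  refine le_comap_pow_of_iterate_sub_mem F.hom _ J _ hM hFM hJF r.hom θ.hom
    (((local_hom_TFAE r.hom).out 0 3).mp hr') (((local_hom_TFAE θ.hom).out 0 3).mp hθ')
    ((hJ _ θ).mp hqι) n t ?_ ha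
  rw [← hr, ← hθ, Category.assoc, schemeIter_mul, ← spec_map_pow_fromSpecStalk hF,
    ← Spec.map_comp_assoc] at ht
  exact congrMod_spec_map_comp_iff.mp ht

open IsLocalRing in
theorem comp_apply_closedPoint {R : Type} [CommRing R] [IsLocalRing R] {X Y : Scheme}
    (g : Spec (CommRingCat.of R) ⟶ X) (f : X ⟶ Y) :
    (g ≫ f) (closedPoint R) = f (g (closedPoint R)) :=
  Scheme.Hom.comp_apply g f _

open IsLocalRing in
theorem exists_ge_congrMod {R : Type} [CommRing R] [IsLocalRing R] [IsNoetherianRing R]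
    {X : Scheme} {P : ℕ → (Spec (CommRingCat.of R) ⟶ X)} {q : Spec (CommRingCat.of R) ⟶ X}
    (hacc : ∀ n, ∃ k, CongrMod (maximalIdeal R ^ n) (P k) q) (hP : ∀ k, P k ≠ q) (n N : ℕ) :
    ∃ k ≥ N, CongrMod (maximalIdeal R ^ n) (P k) q := by
  have h (k : ℕ) : ∃ l, ¬ CongrMod (maximalIdeal R ^ l) (P k) q := by
    by_contra! h
    exact hP k (eq_of_forall_congrMod h)
  choose l hl using h
  obtain ⟨k, hk⟩ := hacc (n + (Finset.range N).sup l)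
  refine ⟨k, ?_, hk.mono (Ideal.pow_le_pow_right (Nat.le_add_right _ _))⟩
  by_contra! hkN
  exact hl k (hk.mono (Ideal.pow_le_pow_right
    ((Finset.le_sup (Finset.mem_range.mpr hkN)).trans (Nat.le_add_left _ _))))

open IsLocalRing in
/-- If an orbit accumulates at a section not belonging to it, then the closed point of this section
is periodic, and for every multiple of the period the orbit of some member of the original orbit
under that iterate already accumulates there. -/
theorem exists_period_of_orbit_accumulates {R : Type} [CommRing R] [IsLocalRing R]
    [IsNoetherianRing R] {X : Scheme} {φ : X ⟶ X} {p q : Spec (CommRingCat.of R) ⟶ X}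
    (hacc : ∀ n, ∃ k, CongrMod (maximalIdeal R ^ n) (p ≫ schemeIter φ k) q)
    (hpq : ∀ k, p ≫ schemeIter φ k ≠ q) :
    ∃ k₀ L, 0 < L ∧ (p ≫ schemeIter φ k₀) (closedPoint R) = q (closedPoint R) ∧
      schemeIter φ L (q (closedPoint R)) = q (closedPoint R) ∧
      ∀ c, 0 < c → ∃ i, (p ≫ schemeIter φ i) (closedPoint R) = q (closedPoint R) ∧
        ∀ n, ∃ t, CongrMod (maximalIdeal R ^ n)
          ((p ≫ schemeIter φ i) ≫ schemeIter φ (L * c * t)) q := by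
  have happly (i j : ℕ) : (p ≫ schemeIter φ (i + j)) (closedPoint R) =
      schemeIter φ j ((p ≫ schemeIter φ i) (closedPoint R)) := by
    rw [schemeIter_add, ← Category.assoc, comp_apply_closedPoint]
  obtain ⟨k₀, -, hk₀⟩ := exists_ge_congrMod hacc hpq 1 0
  obtain ⟨k₁, hk, hk₁⟩ := exists_ge_congrMod hacc hpq 1 (k₀ + 1)
  obtain ⟨L, rfl⟩ := Nat.exists_eq_add_of_le (Nat.le_of_succ_le hk)
  have hx₀ := hk₀.apply_closedPoint (pow_one _).le
  have hx₁ := hk₁.apply_closedPoint (pow_one _).le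
  rw [happly, hx₀] at hx₁
  refine ⟨k₀, L, by omega, hx₀, hx₁, fun c hc ↦ ?_⟩
  have hLc : 0 < L * c := Nat.mul_pos (by omega) hc
  by_contra! hcon
  have h (i : ℕ) : ∃ n, (p ≫ schemeIter φ i) (closedPoint R) = q (closedPoint R) →
      ∀ t, ¬ CongrMod (maximalIdeal R ^ n)
        ((p ≫ schemeIter φ i) ≫ schemeIter φ (L * c * t)) q := by
    by_cases hi : (p ≫ schemeIter φ i) (closedPoint R) = q (closedPoint R)
    · obtain ⟨n, hn⟩ := hcon i hi
      exact ⟨n, fun _ ↦ hn⟩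
    · exact ⟨0, fun h ↦ absurd h hi⟩
  choose l hl using h
  obtain ⟨k, hk, hkq⟩ := exists_ge_congrMod hacc hpq
    (1 + (Finset.range (L * c)).sup fun i ↦ l (k₀ + i)) k₀
  obtain ⟨d, rfl⟩ := Nat.exists_eq_add_of_le hk
  have hkx := hkq.apply_closedPoint (Ideal.pow_le_self (by omega))
  have hd := Nat.mod_add_div d (L * c)
  have hi : d % (L * c) < L * c := Nat.mod_lt _ hLc
  generalize d % (L * c) = i at hd hi
  generalize d / (L * c) = t at hd
  subst hd
  refine hl (k₀ + i) ?_ t ?_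
  · rw [← hkx, add_comm i, ← add_assoc, happly _ i, happly _ i, happly, hx₀, mul_assoc,
      schemeIter_mul_apply_of_fixed φ hx₁]
  · rw [Category.assoc, ← schemeIter_add, add_assoc]
    exact hkq.mono (Ideal.pow_le_pow_right
      ((Finset.le_sup (f := fun i ↦ l (k₀ + i)) (Finset.mem_range.mpr hi)).trans
        (Nat.le_add_left _ _)))

open IsLocalRing in
theorem etaleAtPt_schemeIter_apply {R : Type} [CommRing R] [IsLocalRing R] {X : Scheme}
    {φ : X ⟶ X} {p : Spec (CommRingCat.of R) ⟶ X}
    (het : ∀ k, EtaleAtPt φ ((p ≫ schemeIter φ k) (closedPoint R))) {k₀ : ℕ} {x : X}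
    (hx : (p ≫ schemeIter φ k₀) (closedPoint R) = x) (k : ℕ) :
    EtaleAtPt φ (schemeIter φ k x) := by
  have h := het (k₀ + k)
  rwa [schemeIter_add, ← Category.assoc, comp_apply_closedPoint, hx] at h

open IsLocalRing in
theorem exists_comp_eq_of_invariant {R : Type} [CommRing R] [IsLocalRing R] [IsNoetherianRing R]
    {X Z : Scheme} (sX : X ⟶ Spec (CommRingCat.of R)) [LocallyOfFiniteType sX]
    {φ : X ⟶ X} (hφ : φ ≫ sX = sX) {p q : Spec (CommRingCat.of R) ⟶ X}
    (het : ∀ k, EtaleAtPt φ ((p ≫ schemeIter φ k) (closedPoint R)))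
    (ι : Z ⟶ X) [IsClosedImmersion ι] {M : ℕ} (hM : 0 < M) {ψ : Z ⟶ Z}
    (hψ : ι ≫ schemeIter φ M = ψ ≫ ι) (hq : q ≫ sX = 𝟙 _) (hqι : ∃ s, s ≫ ι = q)
    (hacc : ∀ n, ∃ k, CongrMod (maximalIdeal R ^ n) (p ≫ schemeIter φ k) q) :
    ∃ k s, s ≫ ι = p ≫ schemeIter φ k := by
  by_cases hpq : ∀ k, p ≫ schemeIter φ k ≠ q
  · obtain ⟨k₀, L, -, hk₀, hL, hLc⟩ := exists_period_of_orbit_accumulates hacc hpq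
    obtain ⟨i, hix, hi⟩ := hLc M hM
    refine ⟨i, exists_comp_eq_of_orbit_accumulates sX hφ (etaleAtPt_schemeIter_apply het hk₀)
      (schemeIter_mul_apply_of_fixed φ hL M) ι (ψ := schemeIter ψ L) ?_ hix hq rfl hqι hi⟩
    rw [mul_comm, schemeIter_mul, comp_schemeIter_of_semiconj hψ]
  · push Not at hpq
    obtain ⟨k, rfl⟩ := hpq
    exact ⟨k, hqι⟩

open IsLocalRing in
theorem exists_eq_of_preperiodic {R : Type} [CommRing R] [IsLocalRing R] [IsNoetherianRing R]
    {X : Scheme} (sX : X ⟶ Spec (CommRingCat.of R)) [LocallyOfFiniteType sX] [IsSeparated sX]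
    {φ : X ⟶ X} (hφ : φ ≫ sX = sX) {p q : Spec (CommRingCat.of R) ⟶ X}
    (hp : p ≫ sX = 𝟙 _) (het : ∀ k, EtaleAtPt φ ((p ≫ schemeIter φ k) (closedPoint R)))
    (hq : q ≫ sX = 𝟙 _) {a b : ℕ} (hab : a < b)
    (hqab : q ≫ schemeIter φ a = q ≫ schemeIter φ b)
    (hacc : ∀ n, ∃ k, CongrMod (maximalIdeal R ^ n) (p ≫ schemeIter φ k) q) :
    ∃ k, p ≫ schemeIter φ k = q := by
  by_contra! hpq
  obtain ⟨k₀, L, hL0, hk₀, hL, hLc⟩ := exists_period_of_orbit_accumulates hacc hpq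
  obtain ⟨d, rfl⟩ := Nat.exists_eq_add_of_le hab.le
  obtain ⟨i, hix, hi⟩ := hLc d (by omega)
  have hetx := etaleAtPt_schemeIter_apply het hk₀
  have hLd := schemeIter_mul_apply_of_fixed φ hL d
  have hper (e : ℕ) (he : a ≤ e) (n : ℕ) :
      q ≫ schemeIter φ (e + d * n) = q ≫ schemeIter φ e := by
    induction n with
    | zero => rfl
    | succ n ih =>
      obtain ⟨f, rfl⟩ := Nat.exists_eq_add_of_le he
      rw [← ih, show a + f + d * (n + 1) = a + d + (f + d * n) by ring,
        show a + f + d * n = a + (f + d * n) by ring, schemeIter_add φ (a + d),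
        ← Category.assoc, ← hqab, Category.assoc, ← schemeIter_add]
  have hfix : q ≫ schemeIter φ (L * d) = q := by
    refine eq_of_comp_schemeIter_eq hφ hetx (schemeIter_mul_apply_of_fixed φ hL a)
      (by rw [comp_apply_closedPoint, hLd]) hq rfl ?_
    rw [Category.assoc, ← schemeIter_add, add_comm, mul_comm L d]
    exact hper _ (Nat.le_mul_of_pos_left a hL0) L
  have : IsClosedImmersion q := by
    have : IsClosedImmersion (q ≫ sX) := by rw [hq]; infer_instance
    exact IsClosedImmersion.of_comp q sX
  obtain ⟨s, hs⟩ := exists_comp_eq_of_orbit_accumulates sX hφ hetx hLd q (ψ := 𝟙 _)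
    (by rw [hfix, Category.id_comp]) hix hq rfl ⟨𝟙 _, Category.id_comp _⟩ hi
  have hs1 : s = 𝟙 _ := by
    rw [← Category.comp_id s, ← hq, ← Category.assoc, hs, Category.assoc,
      schemeIter_comp_of_comp_eq hφ, hp, hq]
  exact hpq i (by rw [← hs, hs1, Category.id_comp])

/-- **Avoidance of an invariant subscheme in the étale / unramified situation**
(Theorem 3.10).

Let `K` be a number field or a function field of characteristic 0, `𝔭` a non-archimedean
place of `K` with completion `K_𝔭` and valuation ring `𝒪_𝔭`, `𝒳` a separated scheme of
finite type over `𝒪_𝔭`, `φ` an endomorphism of `𝒳` over `𝒪_𝔭`, and `P ∈ 𝒳(𝒪_𝔭)`. Assume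
`𝒳` is smooth over `𝒪_𝔭` and `φ` is étale at (the closed point of) every point of the
orbit `O_φ(P)`, and let `𝒱` be a reduced closed subscheme of `𝒳`. Assume (a) `φ^M(𝒱) ⊆ 𝒱`
for some `M > 0`, and, when `K` is a function field, that the reduction of `P` mod `𝔭` is
`φ`-preperiodic; or (b) `𝒱(𝒪_𝔭)` is a finite set of `φ`-preperiodic points. If `𝒱(𝒪_𝔭)`
does not meet `O_φ(P)`, then it does not meet the `𝔭`-adic closure of `O_φ(P)`
(where `Q` lies in the `𝔭`-adic closure iff for every `m` it is congruent to some orbit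
point modulo `𝔭^m`). -/
theorem etale_avoidance_of_invariant_subscheme
    (K : Type) [Field K] (κ : Subfield K)
    (hK : NumberFieldOrFunctionFieldOver K κ)
    (w : PlaceK K) (hw : w.IsNonarch) (hwκ : w.IsPlaceOver κ)
    (Cw : CompletionOf w)
    (hna : ∀ x y : Cw.carrier, Cw.absv (x + y) ≤ max (Cw.absv x) (Cw.absv y))
    (X : Scheme)
    (sX : X ⟶ Spec (CommRingCat.of (avSubring Cw.absv hna)))
    (hsep : AlgebraicGeometry.IsSeparated sX)
    (hft : LocallyOfFiniteType sX) (hqc : QuasiCompact sX)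
    (φ : X ⟶ X) (hφ : φ ≫ sX = sX)
    (p : Spec (CommRingCat.of (avSubring Cw.absv hna)) ⟶ X)
    (hp : p ≫ sX = 𝟙 _)
    (hsm : ∀ k : ℕ, SmoothAtPt sX ((p ≫ schemeIter φ k).base
      ((⟨avMaxIdeal Cw.absv hna, avMaxIdeal_isPrime Cw.absv hna⟩ :
        PrimeSpectrum (avSubring Cw.absv hna)) :
          Spec (CommRingCat.of (avSubring Cw.absv hna)))))
    (het : ∀ k : ℕ, EtaleAtPt φ ((p ≫ schemeIter φ k).base
      ((⟨avMaxIdeal Cw.absv hna, avMaxIdeal_isPrime Cw.absv hna⟩ :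
        PrimeSpectrum (avSubring Cw.absv hna)) :
          Spec (CommRingCat.of (avSubring Cw.absv hna)))))
    (Z : Scheme) (ι : Z ⟶ X) (hι : IsClosedImmersion ι) (hred : IsReduced Z)
    (hab :
      -- (a): V is eventually invariant, and in the function field case P is
      -- preperiodic modulo 𝔭
      ((∃ M : ℕ, 0 < M ∧ ∃ ψ : Z ⟶ Z, ι ≫ schemeIter φ M = ψ ≫ ι) ∧
        (¬ NumberField K →
          ∃ a b : ℕ, a < b ∧
            Spec.map (CommRingCat.ofHom (Ideal.Quotient.mk (avMaxIdeal Cw.absv hna))) ≫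
                (p ≫ schemeIter φ a) =
              Spec.map (CommRingCat.ofHom (Ideal.Quotient.mk (avMaxIdeal Cw.absv hna))) ≫
                (p ≫ schemeIter φ b))) ∨
      -- (b): V(𝒪_𝔭) is a finite set of φ-preperiodic points
      (∃ Q : Set (Spec (CommRingCat.of (avSubring Cw.absv hna)) ⟶ X), Q.Finite ∧
        (∀ q ∈ Q, q ≫ sX = 𝟙 _ ∧ ∃ a b : ℕ, a < b ∧
          q ≫ schemeIter φ a = q ≫ schemeIter φ b) ∧
        ∀ r : Spec (CommRingCat.of (avSubring Cw.absv hna)) ⟶ X, r ≫ sX = 𝟙 _ →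
          ((∃ s, s ≫ ι = r) ↔ r ∈ Q)))
    (hdisj : ∀ k : ℕ, ¬ ∃ s : Spec (CommRingCat.of (avSubring Cw.absv hna)) ⟶ Z,
      s ≫ ι = p ≫ schemeIter φ k) :
    ∀ q : Spec (CommRingCat.of (avSubring Cw.absv hna)) ⟶ X, q ≫ sX = 𝟙 _ →
      (∀ m : ℕ, ∃ k : ℕ,
        Spec.map (CommRingCat.ofHom (Ideal.Quotient.mk ((avMaxIdeal Cw.absv hna) ^ m))) ≫
            (p ≫ schemeIter φ k) =
          Spec.map (CommRingCat.ofHom (Ideal.Quotient.mk ((avMaxIdeal Cw.absv hna) ^ m))) ≫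
            q) →
      ¬ ∃ s : Spec (CommRingCat.of (avSubring Cw.absv hna)) ⟶ Z, s ≫ ι = q := by
  have h := CompletionOf.exists_uniformizer Cw hna (w.exists_uniformizer hK hw hwκ)
  have : IsDiscreteValuationRing (avSubring Cw.absv hna) :=
    isDiscreteValuationRing_avSubring Cw.absv hna h
  have hm := avMaxIdeal_eq_maximalIdeal Cw.absv hna
  have hpt : (⟨avMaxIdeal Cw.absv hna, avMaxIdeal_isPrime Cw.absv hna⟩ :
      PrimeSpectrum (avSubring Cw.absv hna)) = IsLocalRing.closedPoint _ :=
    PrimeSpectrum.ext hm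
  rw [hpt] at het
  intro q hq hacc
  rw [hm] at hacc
  rintro ⟨s, hs⟩
  rcases hab with ⟨⟨M, hM, ψ, hψ⟩, -⟩ | ⟨Q, -, hQ, hQι⟩
  · obtain ⟨k, hk⟩ := exists_comp_eq_of_invariant sX hφ het ι hM hψ hq ⟨s, hs⟩ hacc
    exact hdisj k hk
  · obtain ⟨-, a, b, hab, hqab⟩ := hQ q ((hQι q hq).mp ⟨s, hs⟩)
    obtain ⟨k, rfl⟩ := exists_eq_of_preperiodic sX hφ hp het hq hab hqab hacc
    exact hdisj k ⟨s, hs⟩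
end

section
/- Let K be a number field or a function field of characteristic 0, and let f ∈ K[X] be a polynomial of degree at least 2. Let α ∈ P^1(K) and let V be a finite subset of P^1(K) such that the forward f-orbit of α does not intersect V. Then there are infinitely many non-archimedean places 𝔭 of K such that the 𝔭-adic closure of the forward f-orbit of α in P^1(K_𝔭) does not intersect V. -/
open Polynomial OnePoint

/-- Action of a polynomial on the projective line `P^1(L) = L ∪ {∞}`:
`∞ ↦ ∞` and `a ↦ f(a)`. -/
def polyEvalP1 {L : Type} [CommRing L] (f : Polynomial L) : OnePoint L → OnePoint L :=
  OnePoint.map fun a => f.eval a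

/-- The diagonally split self-map `(f,…,f)` of `(P^1)^n` (coordinatewise action). -/
def splitMap {L : Type} [CommRing L] {ι : Type} (f : Polynomial L)
    (x : ι → OnePoint L) : ι → OnePoint L :=
  fun i => polyEvalP1 f (x i)

/-- The forward orbit of a point under a self-map. -/
def fwdOrbit {X : Type*} (φ : X → X) (P : X) : Set X :=
  Set.range fun k : ℕ => φ^[k] P

/-- Homogeneous coordinates of a point of `P^1(L)`: `a ↦ (a, 1)`, `∞ ↦ (1, 0)`. -/
def homCoords {L : Type} [CommRing L] (x : OnePoint L) : Fin 2 → L :=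
  Option.elim x ![1, 0] (fun a => ![a, 1])

/-- A polynomial in variables `(i, 0), (i, 1)` (`i : ι`) is multihomogeneous if it is
homogeneous in the pair of variables indexed by each `i` separately. -/
def MultiHomog {K : Type} [CommSemiring K] {ι : Type} [DecidableEq ι]
    (p : MvPolynomial (ι × Fin 2) K) : Prop :=
  ∀ i : ι, ∃ d : ℕ,
    p.IsWeightedHomogeneous (fun jk => if jk.1 = i then (1 : ℕ) else 0) d

/-- A closed subvariety of `(P^1_K)^ι`, given by a set of multihomogeneous equations over `K`. -/
structure ClosedSubvar (K : Type) [CommRing K] (ι : Type) [DecidableEq ι] where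
  polys : Set (MvPolynomial (ι × Fin 2) K)
  homog : ∀ p ∈ polys, MultiHomog p

/-- Whether a multihomogeneous polynomial vanishes at a point of `(P^1(L))^ι`. -/
def vanishesAt {K : Type} [CommRing K] {ι : Type} [DecidableEq ι] {L : Type} [CommRing L]
    (φ : K →+* L) (p : MvPolynomial (ι × Fin 2) K) (x : ι → OnePoint L) : Prop :=
  MvPolynomial.eval (fun jk => homCoords (x jk.1) jk.2) (MvPolynomial.map φ p) = 0

/-- The `L`-points of a closed subvariety, for a `K`-algebra `L` via `φ : K →+* L`. -/
def ClosedSubvar.pts {K : Type} [CommRing K] {ι : Type} [DecidableEq ι]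
    (V : ClosedSubvar K ι) {L : Type} [CommRing L] (φ : K →+* L) :
    Set (ι → OnePoint L) :=
  {x | ∀ p ∈ V.polys, vanishesAt φ p x}

/-- A subset of `(P^1(L))^ι` is Zariski closed if it is the common zero set of a family of
multihomogeneous polynomials over `L`. -/
def IsZarClosed {L : Type} [CommRing L] {ι : Type} [DecidableEq ι]
    (S : Set (ι → OnePoint L)) : Prop :=
  ∃ V : ClosedSubvar L ι, S = V.pts (RingHom.id L)

/-- The Zariski closure of a set of points. -/
def zarClosure {L : Type} [CommRing L] {ι : Type} [DecidableEq ι]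
    (S : Set (ι → OnePoint L)) : Set (ι → OnePoint L) :=
  ⋂₀ {Z | IsZarClosed Z ∧ S ⊆ Z}

/-- An irreducible (closed) subvariety of `(P^1(L))^ι`, as a set of points. -/
def IrrSubvar {L : Type} [CommRing L] {ι : Type} [DecidableEq ι]
    (S : Set (ι → OnePoint L)) : Prop :=
  S.Nonempty ∧ IsZarClosed S ∧
    ∀ Z₁ Z₂ : Set (ι → OnePoint L), IsZarClosed Z₁ → IsZarClosed Z₂ →
      S ⊆ Z₁ ∪ Z₂ → S ⊆ Z₁ ∨ S ⊆ Z₂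

/-- The dimension of a (closed) subvariety, as the Krull dimension of the poset of
irreducible closed subsets contained in it. -/
noncomputable def varDim {L : Type} [CommRing L] {ι : Type} [DecidableEq ι]
    (S : Set (ι → OnePoint L)) : WithBot ℕ∞ :=
  Order.krullDim {T : Set (ι → OnePoint L) // IrrSubvar T ∧ T ⊆ S}

/-- `T` is an irreducible component of `S`: a maximal irreducible closed subset of `S`. -/
def IsComponentOf {L : Type} [CommRing L] {ι : Type} [DecidableEq ι]
    (T S : Set (ι → OnePoint L)) : Prop :=
  IrrSubvar T ∧ T ⊆ S ∧ ∀ T', IrrSubvar T' → T ⊆ T' → T' ⊆ S → T' = T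

/-- A hypersurface in `(P^1(L))^n`: a nonempty Zariski closed set all of whose irreducible
components have dimension `n - 1`. -/
def IsHypersurfaceSet {L : Type} [CommRing L] {n : ℕ}
    (S : Set (Fin n → OnePoint L)) : Prop :=
  S.Nonempty ∧ IsZarClosed S ∧
    ∀ T, IsComponentOf T S → varDim T = ((n - 1 : ℕ) : ℕ∞)

/-- A set of points (e.g. a subvariety) is periodic under the split map `(f,…,f)`. -/
def SubvarPeriodic {L : Type} [CommRing L] {ι : Type} (f : Polynomial L)
    (S : Set (ι → OnePoint L)) : Prop :=
  ∃ m : ℕ, 1 ≤ m ∧ (splitMap f)^[m] '' S = S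

/-- A set of points (e.g. a subvariety) is preparation under `(f,…,f)`. -/
def SubvarPreperiodic {L : Type} [CommRing L] {ι : Type} (f : Polynomial L)
    (S : Set (ι → OnePoint L)) : Prop :=
  ∃ k : ℕ, SubvarPeriodic f ((splitMap f)^[k] '' S)

/-- At the place `w`, the `w`-adic closure of the `(f,…,f)`-orbit of `P` does not meet
`V(K_w)`: for every completion of `K` at `w`, the `w`-adic closure of the orbit in
`(P^1)^n` of the completion is disjoint from the set of points of `V` over the
completion. -/
def OrbitClosureAvoids {K : Type} [Field K] {n : ℕ} (w : PlaceK K)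
    (f : Polynomial K) (P : Fin n → OnePoint K) (V : ClosedSubvar K (Fin n)) : Prop :=
  ∀ C : CompletionOf w,
    adicClosure C.absv
        (fwdOrbit (splitMap (f.map C.emb)) fun i => mapPoint C.emb (P i)) ∩
      V.pts C.emb = ∅

/-- There are infinitely many (pairwise inequivalent) non-archimedean places of `K`
(trivial on the ground field `κ` in the function field case) satisfying `Q`. -/
def InfinitelyManyPlaces (K : Type) [Field K] (κ : Subfield K)
    (Q : PlaceK K → Prop) : Prop :=
  ∃ T : Set (PlaceK K), T.Infinite ∧
    (T.Pairwise fun w w' => ¬ PlaceK.Equiv w w') ∧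
    ∀ w ∈ T, w.IsNonarch ∧ w.IsPlaceOver κ ∧ Q w

/-- All but finitely many non-archimedean places of `K` (trivial on the ground field `κ`
in the function field case) satisfy `Q`. -/
def AllButFinitelyManyPlaces (K : Type) [Field K] (κ : Subfield K)
    (Q : PlaceK K → Prop) : Prop :=
  ∃ T : Set (PlaceK K), T.Finite ∧
    ∀ w : PlaceK K, w.IsNonarch → w.IsPlaceOver κ →
      (∃ w' ∈ T, PlaceK.Equiv w w') ∨ Q w

theorem exists_comp_eq_add_derivative_mul {R : Type} [CommRing R] (f p : R[X]) :
    ∃ r : R[X], f.comp p = f + derivative f * (p - X) + r * (p - X) ^ 2 := by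
  obtain ⟨r, hr⟩ := (f.map C).binomExpansion X (p - X)
  refine ⟨r, ?_⟩
  simpa [eval_map, derivative_map, comp] using hr

/-- The polynomial `f^k(X) - X` is divisible by `f(X) - X`; at a fixed point `c` of `f` the quotient
takes the value `1 + f'(c) + ⋯ + f'(c)^(k-1)`. -/
theorem exists_iterate_comp_sub_X_factor {K L : Type} [Field K] [Field L] [Algebra K L]
    (f : K[X]) (k : ℕ) :
    ∃ g : K[X], f.comp^[k] X - X = (f - X) * g ∧
      ∀ c : L, aeval c f = c →
        aeval c g = ∑ i ∈ Finset.range k, aeval c (derivative f) ^ i := by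
  induction k with
  | zero => exact ⟨0, by simp, by simp⟩
  | succ k ih =>
    obtain ⟨g, hg, hgc⟩ := ih
    obtain ⟨r, hr⟩ := exists_comp_eq_add_derivative_mul f (f.comp^[k] X)
    refine ⟨g * (derivative f + r * ((f - X) * g)) + 1, ?_, fun c hc => ?_⟩
    · rw [Function.iterate_succ_apply', hr, hg]
      ring
    · simp [geom_sum_succ, hgc c hc, hc, mul_comm]

theorem aeval_iterate_comp_X {K L : Type} [Field K] [Field L] [Algebra K L] (f : K[X]) (k : ℕ)
    (c : L) : aeval c (f.comp^[k] X) = (fun x => aeval x f)^[k] c := by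
  simp [aeval_def, iterate_comp_eval₂]

theorem iterate_comp_X_comp {R : Type} [CommRing R] (f p : R[X]) (k : ℕ) :
    (f.comp^[k] X).comp p = f.comp^[k] p := by
  induction k with
  | zero => simp
  | succ k ih => rw [Function.iterate_succ_apply', Function.iterate_succ_apply', comp_assoc, ih]

theorem exists_coprime_comp_factor {K : Type} [Field K] [CharZero K] (f : K[X])
    (hf : 2 ≤ f.natDegree) (V : Finset K) :
    ∃ g q : K[X], 1 ≤ g.natDegree ∧ g.comp f = g * q ∧ IsCoprime g q ∧
      ∀ v ∈ V, g.eval v ≠ 0 := by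
  classical
  let L := AlgebraicClosure K
  let φ : L → L := fun x => aeval x f
  have hd0 : derivative f ≠ 0 := fun h => by
    have := derivative_eq_zero.1 h
    omega
  let B : Finset L := V.image (algebraMap K L) ∪ ((derivative f).aroots L).toFinset
  obtain ⟨k, hk, hkB⟩ := Nat.infinite_setOfPred_prime.exists_notMem_finset
    (B.image (Function.minimalPeriod φ) ∪ B.image fun c => orderOf (aeval c (derivative f)))
  have hk : k.Prime := hk
  obtain ⟨g, hg, hgc⟩ := exists_iterate_comp_sub_X_factor (L := L) f k
  have hper {c : L} (hc : aeval c g = 0) : φ^[k] c = c := by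
    have := congrArg (aeval c) hg
    simpa [aeval_iterate_comp_X, hc, sub_eq_zero] using this
  have hB {c : L} (hcB : c ∈ B) : aeval c g ≠ 0 := by
    intro hc
    refine hkB (Finset.mem_union.2 ?_)
    by_cases hfix : aeval c f = c
    · refine Or.inr (Finset.mem_image.2 ⟨c, hcB, ?_⟩)
      have hs := hgc c hfix
      rw [hc] at hs
      have : Fact k.Prime := ⟨hk⟩
      refine orderOf_eq_prime ?_ fun h1 => ?_
      · have := geom_sum_mul (aeval c (derivative f)) k
        rw [← hs, zero_mul] at this
        exact (sub_eq_zero.1 this.symm)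
      · rw [h1] at hs
        have : CharZero L := charZero_of_injective_algebraMap (algebraMap K L).injective
        simp only [one_pow, Finset.sum_const, Finset.card_range, nsmul_eq_mul, mul_one] at hs
        exact hk.ne_zero (Nat.cast_eq_zero.1 hs.symm)
    · refine Or.inl (Finset.mem_image.2 ⟨c, hcB, ?_⟩)
      have hdvd : Function.minimalPeriod φ c ∣ k :=
        Function.IsPeriodicPt.minimalPeriod_dvd (hper hc)
      refine ((Nat.dvd_prime hk).1 hdvd).resolve_left fun h1 => hfix ?_
      exact Function.minimalPeriod_eq_one_iff_isFixedPt.1 h1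
  have hcrit {c : L} (hc : aeval c g = 0) : aeval c (derivative f) ≠ 0 := fun h => by
    refine hB (Finset.mem_union_right _ ?_) hc
    simpa [hd0] using h
  have hdeg : 1 ≤ g.natDegree := by
    have hX : ∀ p : K[X], 2 ≤ p.natDegree → (p - X).natDegree = p.natDegree := fun p hp =>
      natDegree_sub_eq_left_of_natDegree_lt (by simp; omega)
    have hlt : f.natDegree < f.natDegree ^ k := by
      conv_lhs => rw [← pow_one f.natDegree]
      exact Nat.pow_lt_pow_right (by omega) hk.one_lt
    have hit : (f.comp^[k] X).natDegree = f.natDegree ^ k := by simp [natDegree_iterate_comp]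
    have := congrArg natDegree hg
    rw [hX _ (by omega), hit] at this
    have h2 := natDegree_mul_le (p := f - X) (q := g)
    rw [hX _ hf] at h2
    omega
  have hg0 : g ≠ 0 := fun h => by simp [h] at hdeg
  have hfX : f - X ≠ 0 := fun h => by
    rw [sub_eq_zero.1 h] at hf
    simp at hf
  obtain ⟨r, hr⟩ := exists_comp_eq_add_derivative_mul f f
  obtain ⟨u, hu⟩ := exists_comp_eq_add_derivative_mul f (f.comp^[k] X)
  have hmul : g.comp f * (derivative f + r * (f - X)) =
      g * (derivative f + u * (f.comp^[k] X - X)) := by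
    have hc := congrArg (·.comp f) hg
    have hcomm : (f.comp^[k] X).comp f = f.comp (f.comp^[k] X) := by
      rw [iterate_comp_X_comp, ← Function.iterate_succ_apply' f.comp, Function.iterate_succ_apply,
        comp_X]
    simp only [sub_comp, mul_comp, X_comp, hcomm, hu, hr] at hc
    refine mul_left_cancel₀ hfX ?_
    linear_combination -hc + hg * (derivative f + u * (f.comp^[k] X - X))
  have hcop : IsCoprime g (derivative f + r * (f - X)) := by
    rw [isCoprime_iff_aeval_ne_zero_of_isAlgClosed K L]
    by_contra! ⟨c, hc, hc'⟩
    have h1 : φ (φ c) = φ c := by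
      have := congrArg (aeval c) hr
      simp only [aeval_comp, map_add, map_mul, map_sub, map_pow, aeval_X] at this hc'
      change aeval (aeval c f) f = aeval c f
      linear_combination this + (aeval c f - c) * hc'
    have h2 : φ c = c := by
      have h3 : ∀ n, φ^[n + 1] c = φ c := fun n => by
        induction n with
        | zero => rfl
        | succ n ih => rw [Function.iterate_succ_apply', ih, h1]
      rw [← h3 (k - 1), Nat.sub_add_cancel hk.one_le, hper hc]
    have h2' : aeval c f = c := h2
    simp [h2'] at hc'
    exact hcrit hc hc'
  obtain ⟨q, hq⟩ := hcop.dvd_of_dvd_mul_right (Dvd.intro _ hmul.symm)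
  refine ⟨g, q, hdeg, hq, ?_, fun v hv h => ?_⟩
  · rw [isCoprime_iff_aeval_ne_zero_of_isAlgClosed K L]
    by_contra! ⟨c, hc, hc'⟩
    have hU : q * (derivative f + r * (f - X)) = derivative f + u * (f.comp^[k] X - X) := by
      refine mul_left_cancel₀ hg0 ?_
      rw [← hmul, hq]; ring
    have := congrArg (aeval c) hU
    have hp : (fun x => aeval x f)^[k] c = c := hper hc
    simp only [map_add, map_mul, map_sub, aeval_X, aeval_iterate_comp_X, hp, hc', sub_self,
      mul_zero, zero_mul, add_zero] at this
    exact hcrit hc this.symm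
  · refine hB (c := algebraMap K L v) (by simp [B, hv]) ?_
    simp [aeval_algebraMap_apply, h]

theorem AbsoluteValue.exists_eval_le {K : Type} [Field K] (v : AbsoluteValue K ℝ) (p : K[X]) :
    ∃ C : ℝ, 1 ≤ C ∧ ∀ x, v (p.eval x) ≤ C * max 1 (v x) ^ p.natDegree := by
  refine ⟨1 + ∑ i ∈ Finset.range (p.natDegree + 1), v (p.coeff i),
    le_add_of_nonneg_right (Finset.sum_nonneg fun i _ => v.nonneg _), fun x => ?_⟩
  rw [eval_eq_sum_range, add_mul, Finset.sum_mul]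
  refine (v.sum_le _ _).trans (le_add_of_nonneg_of_le (by positivity) ?_)
  refine Finset.sum_le_sum fun i hi => ?_
  rw [map_mul, map_pow]
  refine mul_le_mul_of_nonneg_left ?_ (v.nonneg _)
  calc v x ^ i ≤ max 1 (v x) ^ i := pow_le_pow_left₀ (v.nonneg _) (le_max_right _ _) _
    _ ≤ _ := pow_le_pow_right₀ (le_max_left _ _) (by simpa [Nat.lt_succ_iff] using hi)

theorem AbsoluteValue.exists_le_eval {K : Type} [Field K] (v : AbsoluteValue K ℝ) (p : K[X])
    (hp : p ≠ 0) :
    ∃ c R : ℝ, 0 < c ∧ 1 ≤ R ∧ ∀ x, R ≤ v x → c * v x ^ p.natDegree ≤ v (p.eval x) := by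
  have hl : 0 < v p.leadingCoeff := v.pos (leadingCoeff_ne_zero.2 hp)
  rcases Nat.eq_zero_or_pos p.natDegree with h0 | hn
  · refine ⟨v p.leadingCoeff, 1, hl, le_rfl, fun x _ => ?_⟩
    rw [eq_C_of_natDegree_eq_zero h0]
    simp
  · obtain ⟨C, hC, h⟩ := v.exists_eval_le p.eraseLead
    refine ⟨v p.leadingCoeff / 2, max 1 (2 * C / v p.leadingCoeff), by positivity,
      le_max_left _ _, fun x hx => ?_⟩
    have h1 : 1 ≤ v x := (le_max_left _ _).trans hx
    have h2 : 2 * C ≤ v x * v p.leadingCoeff :=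
      (div_le_iff₀ hl).1 ((le_max_right _ _).trans hx)
    have h3 : v (p.eraseLead.eval x) ≤ C * v x ^ (p.natDegree - 1) := by
      refine (h x).trans (mul_le_mul_of_nonneg_left ?_ (by linarith))
      rw [max_eq_right h1]
      exact pow_le_pow_right₀ h1 (eraseLead_natDegree_le p)
    have h4 : v p.leadingCoeff * v x ^ p.natDegree ≤ v (p.eval x) + v (p.eraseLead.eval x) := by
      have : p.leadingCoeff * x ^ p.natDegree = p.eval x - p.eraseLead.eval x := by
        have := congrArg (eval x) p.eraseLead_add_C_mul_X_pow
        simp only [eval_add, eval_mul, eval_C, eval_pow, eval_X] at this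
        linear_combination this
      rw [← map_pow, ← map_mul, this]
      exact v.sub_le_add _ _
    have h5 : C * v x ^ (p.natDegree - 1) ≤ v p.leadingCoeff / 2 * v x ^ p.natDegree := by
      rw [← Nat.sub_add_cancel hn, pow_succ, Nat.add_sub_cancel]
      have : 0 ≤ v x ^ (p.natDegree - 1) := by positivity
      nlinarith
    linarith

/-- Along an orbit, absolute values of polynomial expressions grow at most doubly exponentially. -/
theorem AbsoluteValue.exists_log_eval_orbit_le {K : Type} [Field K] (v : AbsoluteValue K ℝ)
    (f g : K[X]) (hf : 2 ≤ f.natDegree) (x : ℕ → K) (hx : ∀ m, x (m + 1) = f.eval (x m)) :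
    ∃ C : ℝ, 0 ≤ C ∧ ∀ m, Real.log (v (g.eval (x m))) ≤ C * (f.natDegree : ℝ) ^ m := by
  obtain ⟨A, hA, hfA⟩ := v.exists_eval_le f
  obtain ⟨B, hB, hgB⟩ := v.exists_eval_le g
  have hd : (2 : ℝ) ≤ f.natDegree := by exact_mod_cast hf
  let l : ℕ → ℝ := fun m => Real.log (max 1 (v (x m)))
  have hl0 : ∀ m, 0 ≤ l m := fun m => Real.log_nonneg (le_max_left _ _)
  have hA0 : 0 ≤ Real.log A := Real.log_nonneg hA
  have hB0 : 0 ≤ Real.log B := Real.log_nonneg hB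
  have hstep : ∀ m, l (m + 1) ≤ Real.log A + f.natDegree * l m := fun m => by
    have h1 : 1 ≤ max 1 (v (x m)) := le_max_left _ _
    have : max 1 (v (x (m + 1))) ≤ A * max 1 (v (x m)) ^ f.natDegree := by
      refine max_le ?_ (hx m ▸ hfA (x m))
      exact one_le_mul_of_one_le_of_one_le hA (one_le_pow₀ h1)
    calc l (m + 1) ≤ Real.log (A * max 1 (v (x m)) ^ f.natDegree) :=
          Real.log_le_log (by positivity) this
      _ = _ := by rw [Real.log_mul (by positivity) (by positivity), Real.log_pow]
  have hl : ∀ m, l m + Real.log A ≤ (l 0 + Real.log A) * (f.natDegree : ℝ) ^ m := fun m => by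
    induction m with
    | zero => simp
    | succ m ih =>
      rw [pow_succ, ← mul_assoc]
      nlinarith [hstep m, hl0 m]
  refine ⟨Real.log B + g.natDegree * (l 0 + Real.log A),
    add_nonneg hB0 (mul_nonneg (Nat.cast_nonneg _) (add_nonneg (hl0 0) hA0)), fun m => ?_⟩
  have hpow : (1 : ℝ) ≤ (f.natDegree : ℝ) ^ m := one_le_pow₀ (by linarith)
  have hmain : Real.log (v (g.eval (x m))) ≤ Real.log B + g.natDegree * l m := by
    rcases eq_or_ne (g.eval (x m)) 0 with h0 | h0
    · simp only [h0, map_zero, Real.log_zero]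
      exact add_nonneg hB0 (mul_nonneg (Nat.cast_nonneg _) (hl0 m))
    · calc _ ≤ Real.log (B * max 1 (v (x m)) ^ g.natDegree) :=
            Real.log_le_log (v.pos h0) (hgB _)
        _ = _ := by rw [Real.log_mul (by positivity) (by positivity), Real.log_pow]
  have h2 : (g.natDegree : ℝ) * l m ≤
      g.natDegree * ((l 0 + Real.log A) * (f.natDegree : ℝ) ^ m) :=
    mul_le_mul_of_nonneg_left (by linarith [hl m]) (Nat.cast_nonneg _)
  nlinarith

/-- If an orbit is unbounded, the values of a nonconstant polynomial along it grow doubly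
exponentially. -/
theorem AbsoluteValue.exists_le_log_eval_orbit {K : Type} [Field K] (v : AbsoluteValue K ℝ)
    (f g : K[X]) (hf : 2 ≤ f.natDegree) (hg : 1 ≤ g.natDegree) (x : ℕ → K)
    (hx : ∀ m, x (m + 1) = f.eval (x m)) (hunb : ∀ R : ℝ, ∃ m, R < v (x m)) :
    ∃ c : ℝ, 0 < c ∧ ∃ m₀, ∀ m ≥ m₀, c * (f.natDegree : ℝ) ^ m ≤ Real.log (v (g.eval (x m))) := by
  have hf0 : f ≠ 0 := fun h => by simp [h] at hf
  have hg0 : g ≠ 0 := fun h => by simp [h] at hg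
  obtain ⟨a, R, ha, hR, hfa⟩ := v.exists_le_eval f hf0
  obtain ⟨b, S, hb, hS, hgb⟩ := v.exists_le_eval g hg0
  have hd : (2 : ℝ) ≤ f.natDegree := by exact_mod_cast hf
  have hg1 : (1 : ℝ) ≤ g.natDegree := by exact_mod_cast hg
  let l : ℕ → ℝ := fun m => Real.log (v (x m))
  -- A lower bound for the logarithm beyond which the orbit escapes.
  let D : ℝ := |Real.log a| + |Real.log b| + Real.log R + Real.log S + 1
  have hlogR : 0 ≤ Real.log R := Real.log_nonneg hR
  have hlogS : 0 ≤ Real.log S := Real.log_nonneg hS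
  have haD : -Real.log a ≤ D := by
    have := neg_le_abs (Real.log a); have := abs_nonneg (Real.log b); simp only [D]; linarith
  have hbD : -Real.log b ≤ D := by
    have := neg_le_abs (Real.log b); have := abs_nonneg (Real.log a); simp only [D]; linarith
  have hRD : Real.log R < D := by
    have := abs_nonneg (Real.log b); have := abs_nonneg (Real.log a); simp only [D]; linarith
  have hSD : Real.log S < D := by
    have := abs_nonneg (Real.log b); have := abs_nonneg (Real.log a); simp only [D]; linarith
  have hD0 : 0 < D := hlogR.trans_lt hRD
  have hpos : ∀ m, D < l m → 0 < v (x m) := fun m hm => by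
    by_contra h
    have : v (x m) = 0 := le_antisymm (not_lt.1 h) (v.nonneg _)
    simp only [l, this, Real.log_zero] at hm
    linarith
  have hle : ∀ T : ℝ, 1 ≤ T → Real.log T < D → ∀ m, D < l m → T ≤ v (x m) := fun T hT hTD m hm =>
    (Real.log_le_log_iff (by linarith) (hpos m hm)).1 (hTD.trans hm).le
  have hstep : ∀ m, D < l m → f.natDegree * (l m - D) ≤ l (m + 1) - D := fun m hm => by
    have h0 := hpos m hm
    have h1 := hfa _ (hle R hR hRD m hm)
    rw [← hx] at h1
    have h2 := Real.log_le_log (by positivity) h1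
    rw [Real.log_mul (by positivity) (by positivity), Real.log_pow] at h2
    simp only [l] at *
    nlinarith
  obtain ⟨m₀, hm₀⟩ := hunb (Real.exp (2 * D))
  have hl₀ : 2 * D < l m₀ := (Real.lt_log_iff_exp_lt ((Real.exp_pos _).trans hm₀)).2 hm₀
  have hgrow : ∀ n, D * (f.natDegree : ℝ) ^ n < l (m₀ + n) - D := fun n => by
    induction n with
    | zero => simp; linarith
    | succ n ih =>
      have hp : 0 < D * (f.natDegree : ℝ) ^ n := by positivity
      have := hstep (m₀ + n) (by linarith)
      rw [pow_succ, ← add_assoc]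
      nlinarith
  refine ⟨D / (f.natDegree : ℝ) ^ m₀, by positivity, m₀, fun m hm => ?_⟩
  obtain ⟨n, rfl⟩ := Nat.exists_eq_add_of_le hm
  have hp : 0 < D * (f.natDegree : ℝ) ^ n := by positivity
  have h1 : D < l (m₀ + n) := by linarith [hgrow n]
  have h0 := hpos _ h1
  have h2 := Real.log_le_log (by positivity) (hgb _ (hle S hS hSD _ h1))
  rw [Real.log_mul (by positivity) (by positivity), Real.log_pow] at h2
  have h3 : D / (f.natDegree : ℝ) ^ m₀ * (f.natDegree : ℝ) ^ (m₀ + n) =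
      D * (f.natDegree : ℝ) ^ n := by
    rw [pow_add]; field_simp
  rw [h3]
  have := hgrow n
  simp only [l] at *
  nlinarith

/-- Where `g` is small, the cofactor `q` coprime to it is bounded above and below. -/
theorem AbsoluteValue.exists_abs_log_le_of_isCoprime {K : Type} [Field K] (v : AbsoluteValue K ℝ)
    (g q : K[X]) (hg : 1 ≤ g.natDegree) (hgq : IsCoprime g q) :
    ∃ D : ℝ, 0 ≤ D ∧ ∀ x, g.eval x ≠ 0 → Real.log (v (g.eval x)) < -D →
      q.eval x ≠ 0 ∧ |Real.log (v (q.eval x))| ≤ D := by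
  have hg0 : g ≠ 0 := fun h => by simp [h] at hg
  obtain ⟨c, R, hc, hR, hgc⟩ := v.exists_le_eval g hg0
  obtain ⟨a, b, hab⟩ := hgq
  obtain ⟨A, hA, hAa⟩ := v.exists_eval_le a
  obtain ⟨B, hB, hBb⟩ := v.exists_eval_le b
  obtain ⟨Q, hQ, hQq⟩ := v.exists_eval_le q
  let A' := A * R ^ a.natDegree
  let B' := B * R ^ b.natDegree
  let Q' := Q * R ^ q.natDegree
  have hA' : 1 ≤ A' := one_le_mul_of_one_le_of_one_le hA (one_le_pow₀ hR)
  have hB' : 1 ≤ B' := one_le_mul_of_one_le_of_one_le hB (one_le_pow₀ hR)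
  have hQ' : 1 ≤ Q' := one_le_mul_of_one_le_of_one_le hQ (one_le_pow₀ hR)
  have hlA := Real.log_nonneg hA'
  have hlB : 0 ≤ Real.log (2 * B') := Real.log_nonneg (by linarith)
  have hlA2 : 0 ≤ Real.log (2 * A') := Real.log_nonneg (by linarith)
  have hlQ := Real.log_nonneg hQ'
  refine ⟨|Real.log c| + Real.log (2 * A') + Real.log (2 * B') + Real.log Q', by positivity,
    fun x hx0 hx => ?_⟩
  have hvg := v.pos hx0
  have habs := abs_nonneg (Real.log c)
  have hxR : v x ≤ R := by
    by_contra! h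
    have h1 := hgc x h.le
    have h2 : c ≤ v (g.eval x) :=
      le_trans (le_mul_of_one_le_right hc.le (one_le_pow₀ (hR.trans h.le))) h1
    have := Real.log_le_log hc h2
    have := neg_abs_le (Real.log c)
    linarith
  have hbd : ∀ (p : K[X]) (P : ℝ), 1 ≤ P → v (p.eval x) ≤ P * max 1 (v x) ^ p.natDegree →
      v (p.eval x) ≤ P * R ^ p.natDegree := fun p P hP h =>
    h.trans (mul_le_mul_of_nonneg_left
      (pow_le_pow_left₀ (by positivity) (max_le hR hxR) _) (by linarith))
  have ha' := hbd a A hA (hAa x)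
  have hb' := hbd b B hB (hBb x)
  have hq' := hbd q Q hQ (hQq x)
  have hgA : v (g.eval x) * (2 * A') ≤ 1 := by
    rw [← Real.log_nonpos_iff (by positivity), Real.log_mul hvg.ne' (by positivity)]
    linarith
  have h1 : 1 ≤ v (a.eval x) * v (g.eval x) + v (b.eval x) * v (q.eval x) := by
    have := congrArg (eval x) hab
    simp only [eval_add, eval_mul, eval_one] at this
    rw [← map_mul, ← map_mul, ← v.map_one, ← this]
    exact v.add_le _ _
  have h2 : 1 ≤ 2 * B' * v (q.eval x) := by
    have e1 : v (a.eval x) * v (g.eval x) ≤ A' * v (g.eval x) :=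
      mul_le_mul_of_nonneg_right ha' hvg.le
    have e2 : v (b.eval x) * v (q.eval x) ≤ B' * v (q.eval x) :=
      mul_le_mul_of_nonneg_right hb' (v.nonneg _)
    linarith
  have hq0 : q.eval x ≠ 0 := fun h => by
    rw [h, map_zero, mul_zero] at h2
    linarith
  have hvq := v.pos hq0
  refine ⟨hq0, abs_le.2 ⟨?_, ?_⟩⟩
  · have := Real.log_nonneg h2
    rw [Real.log_mul (by positivity) hvq.ne'] at this
    linarith
  · have := Real.log_le_log hvq hq'
    linarith

/-- Finitely many real sequences which vary slowly where they are very negative cannot take turns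
being as negative as an exponential. -/
theorem false_of_exists_le_neg_exp {ι : Type} [Fintype ι] (L : ι → ℕ → ℝ) {C D c d : ℝ}
    (hD : 0 ≤ D) (hc : 0 < c) (hd : 2 ≤ d)
    (hlow : ∀ i m, -(C * d ^ m) ≤ L i m)
    (hstep : ∀ i m, L i m < -D → |L i (m + 1) - L i m| ≤ D) (m₀ : ℕ)
    (hbad : ∀ m ≥ m₀, ∃ i, L i m ≤ -(c * d ^ m)) : False := by
  have hd1 : 1 < d := by linarith
  obtain ⟨j₀, hj₀⟩ := pow_unbounded_of_one_lt ((C + 1) / c) hd1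
  have hj₀ : C + 1 < c * d ^ j₀ := by rwa [div_lt_iff₀' hc] at hj₀
  let J : ℕ := Fintype.card ι * j₀
  have htend := tendsto_pow_atTop_atTop_of_one_lt hd1
  obtain ⟨m₁, hm₁⟩ := Filter.eventually_atTop.1
    (htend.eventually_gt_atTop (max (J * D) ((J + 1) * D / c)))
  -- A sequence which is bad at `m` is not bad at `m + j` for `j₀ ≤ j ≤ J`.
  have hgood : ∀ i, ∀ m ≥ m₁, L i m ≤ -(c * d ^ m) → ∀ j, j₀ ≤ j → j ≤ J →
      ¬ L i (m + j) ≤ -(c * d ^ (m + j)) := by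
    intro i m hm hb j hj hjJ hb'
    have h1 : J * D < d ^ m := (le_max_left _ _).trans_lt (hm₁ m hm)
    have h2 : (J + 1) * D < c * d ^ m := by
      rw [← div_lt_iff₀' hc]
      exact (le_max_right _ _).trans_lt (hm₁ m hm)
    have hnear : ∀ k ≤ J, |L i (m + k) - L i m| ≤ k * D := fun k => by
      induction k with
      | zero => simp
      | succ k ih =>
        intro hk
        have h3 := ih (by omega)
        have hkJ : (k : ℝ) ≤ J := by exact_mod_cast (by omega : k ≤ J)
        have h4 : L i (m + k) < -D := by
          have := (abs_le.1 h3).2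
          nlinarith
        have h5 := hstep i (m + k) h4
        rw [← add_assoc]
        push_cast
        calc _ ≤ |L i (m + k + 1) - L i (m + k)| + |L i (m + k) - L i m| := abs_sub_le _ _ _
          _ ≤ _ := by linarith
    have h6 := (abs_le.1 (hnear j hjJ)).1
    have hjJ' : (j : ℝ) ≤ J := by exact_mod_cast hjJ
    have h7 := hlow i m
    have hdm : 0 < d ^ m := by positivity
    have h8 : d ^ j₀ ≤ d ^ j := pow_le_pow_right₀ hd1.le hj
    have h9 : (C + 1) * d ^ m < c * d ^ (m + j) := by
      rw [pow_add]
      have : C + 1 < c * d ^ j := hj₀.trans_le (mul_le_mul_of_nonneg_left h8 hc.le)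
      nlinarith
    nlinarith
  have : Nonempty ι := ⟨(hbad m₀ le_rfl).choose⟩
  choose! i hi using hbad
  let M := max m₀ m₁
  obtain ⟨a, b, hab, hiab⟩ := Fintype.exists_ne_map_eq_of_card_lt
    (fun a : Fin (Fintype.card ι + 1) => i (M + a * j₀)) (by simp)
  wlog hlt : a < b generalizing a b
  · exact this b a hab.symm hiab.symm (lt_of_le_of_ne (not_lt.1 hlt) hab.symm)
  obtain ⟨n, hn⟩ := Nat.exists_eq_add_of_lt (Fin.lt_def.1 hlt)
  have hb : M + (b : ℕ) * j₀ = M + a * j₀ + (n + 1) * j₀ := by rw [hn]; ring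
  have h1 := hi (M + a * j₀) ((le_max_left _ _).trans (Nat.le_add_right _ _))
  have h2 := hi (M + b * j₀) ((le_max_left _ _).trans (Nat.le_add_right _ _))
  rw [← hiab, hb] at h2
  refine hgood _ _ ((le_max_right _ _).trans (Nat.le_add_right _ _)) h1 _ ?_ ?_ h2
  · exact Nat.le_mul_of_pos_left _ (Nat.succ_pos _)
  · exact Nat.mul_le_mul_right _ (by omega)

/-- If the values along an orbit of a polynomial `g` dividing `g ∘ f` with coprime cofactor satisfy a
product formula for finitely many absolute values, then the orbit is bounded at each of them. -/
theorem orbit_bounded_of_prod_eq_one {K ι : Type} [Field K] [Fintype ι]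
    (v : ι → AbsoluteValue K ℝ) (f g q : K[X]) (hf : 2 ≤ f.natDegree) (hg : 1 ≤ g.natDegree)
    (hgf : g.comp f = g * q) (hgq : IsCoprime g q) (x : ℕ → K)
    (hx : ∀ m, x (m + 1) = f.eval (x m)) (hx0 : ∀ m, g.eval (x m) ≠ 0)
    (hprod : ∀ m, ∏ i, v i (g.eval (x m)) = 1) (i : ι) : ∃ R : ℝ, ∀ m, v i (x m) ≤ R := by
  classical
  by_contra! hunb
  obtain ⟨c, hc, m₀, hm₀⟩ := (v i).exists_le_log_eval_orbit f g hf hg x hx hunb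
  choose C hC0 hC using fun i => (v i).exists_log_eval_orbit_le f g hf x hx
  choose D hD0 hD using fun i => (v i).exists_abs_log_le_of_isCoprime g q hg hgq
  have hd : (2 : ℝ) ≤ f.natDegree := by exact_mod_cast hf
  have hcard : (0 : ℝ) < Fintype.card ι := by exact_mod_cast Fintype.card_pos_iff.2 ⟨i⟩
  let L : ι → ℕ → ℝ := fun i m => Real.log (v i (g.eval (x m)))
  have hsum : ∀ m, ∑ i, L i m = 0 := fun m => by
    rw [← Real.log_prod fun i _ => (v i).ne_zero (hx0 m), hprod, Real.log_one]
  refine false_of_exists_le_neg_exp L (C := ∑ i, C i) (D := ∑ i, D i)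
    (c := c / Fintype.card ι) (d := f.natDegree) (Finset.sum_nonneg fun i _ => hD0 i)
    (by positivity) hd (fun j m => ?_) (fun j m hj => ?_) m₀
    fun m hm => ?_
  · have h1 := hsum m
    rw [← Finset.add_sum_erase _ _ (Finset.mem_univ j)] at h1
    have h2 : ∑ i ∈ Finset.univ.erase j, L i m ≤ ∑ i, C i * (f.natDegree : ℝ) ^ m :=
      (Finset.sum_le_sum fun i _ => hC i m).trans
        (Finset.sum_le_sum_of_subset_of_nonneg (Finset.erase_subset _ _)
          fun i _ _ => mul_nonneg (hC0 i) (by positivity))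
    rw [Finset.sum_mul]
    linarith
  · have hDj : D j ≤ ∑ i, D i := Finset.single_le_sum (fun i _ => hD0 i) (Finset.mem_univ j)
    obtain ⟨hq0, hq⟩ := hD j (x m) (hx0 m) (hj.trans_le (neg_le_neg hDj))
    have : g.eval (x (m + 1)) = g.eval (x m) * q.eval (x m) := by
      rw [hx, ← eval_comp, hgf, eval_mul]
    simp only [L, this, map_mul]
    rw [Real.log_mul ((v j).ne_zero (hx0 m)) ((v j).ne_zero hq0), add_sub_cancel_left]
    exact hq.trans hDj
  · by_contra! hlt
    have h1 := hsum m
    rw [← Finset.add_sum_erase _ _ (Finset.mem_univ i)] at h1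
    have hcd : 0 < c / Fintype.card ι * (f.natDegree : ℝ) ^ m := by positivity
    have h2 : ∑ _j ∈ Finset.univ.erase i, -(c / Fintype.card ι * (f.natDegree : ℝ) ^ m) ≤
        ∑ j ∈ Finset.univ.erase i, L j m := Finset.sum_le_sum fun j _ => (hlt j).le
    have h3 := hm₀ m hm
    rw [Finset.sum_const, Finset.card_erase_of_mem (Finset.mem_univ i), Finset.card_univ,
      nsmul_eq_mul, Nat.cast_sub (Fintype.card_pos_iff.2 ⟨i⟩)] at h2
    have h4 : (Fintype.card ι : ℝ) * (c / Fintype.card ι * (f.natDegree : ℝ) ^ m) =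
        c * (f.natDegree : ℝ) ^ m := by field_simp
    push_cast at h2
    simp only [L] at *
    nlinarith

/-- With respect to the absolute value `w`, the set `X` is bounded and has positive distance from
each point of `V`. -/
def AbsoluteValue.Avoids {K : Type} [Field K] (w : AbsoluteValue K ℝ) (X V : Set K) : Prop :=
  (∃ B, ∀ x ∈ X, w x ≤ B) ∧ ∀ v ∈ V, ∃ ε > 0, ∀ x ∈ X, ε ≤ w (x - v)

theorem AbsoluteValue.Avoids.mono {K : Type} [Field K] {w : AbsoluteValue K ℝ} {X Y V W : Set K}
    (h : w.Avoids X V) (hY : Y ⊆ X) (hW : W ⊆ V) : w.Avoids Y W :=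
  ⟨h.1.imp fun _ hB x hx => hB x (hY hx), fun v hv =>
    (h.2 v (hW hv)).imp fun _ hε => ⟨hε.1, fun x hx => hε.2 x (hY hx)⟩⟩

theorem p1Dist_self {L : Type} [Field L] (w : AbsoluteValue L ℝ) (x : OnePoint L) :
    p1Dist w x x = 0 := by
  induction x using OnePoint.rec with
  | infty => rfl
  | coe a => change w (a - a) / _ = 0; simp

theorem notMem_closure_p1Top {L : Type} [Field L] (w : AbsoluteValue L ℝ) {S : Set (OnePoint L)}
    {x : OnePoint L} {ε : ℝ} (hε : 0 < ε) (h : ∀ y ∈ S, ε ≤ p1Dist w x y) :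
    x ∉ @closure _ (p1Top w) S := by
  let := p1Top w
  intro hx
  have hopen : IsOpen {y | p1Dist w x y < ε} :=
    TopologicalSpace.GenerateOpen.basic _ ⟨x, ε, hε, rfl⟩
  obtain ⟨y, hy, hyS⟩ := mem_closure_iff.1 hx _ hopen (by simpa [p1Dist_self] using hε)
  exact (h y hyS).not_gt hy

theorem fwdOrbit_polyEvalP1_map_coe {K L : Type} [Field K] [Field L] (φ : K →+* L) (f : K[X])
    (a : K) : fwdOrbit (polyEvalP1 (f.map φ)) (mapPoint φ a) =
      Set.range fun m => ((φ ((fun b => f.eval b)^[m] a) : L) : OnePoint L) := by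
  refine congrArg Set.range (funext fun m => ?_)
  induction m with
  | zero => rfl
  | succ m ih =>
    rw [Function.iterate_succ_apply', ih, Function.iterate_succ_apply']
    exact congrArg OnePoint.some (eval_map_apply φ _)

theorem fwdOrbit_polyEvalP1_coe {K : Type} [Field K] (f : K[X]) (a : K) :
    fwdOrbit (polyEvalP1 f) a = Set.range fun m => (((fun b => f.eval b)^[m] a : K) : OnePoint K) := by
  have := fwdOrbit_polyEvalP1_map_coe (RingHom.id K) f a
  rwa [Polynomial.map_id] at this

theorem fwdOrbit_polyEvalP1_infty {K : Type} [Field K] (f : K[X]) :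
    fwdOrbit (polyEvalP1 f) ∞ = {∞} := by
  have : ∀ m, (polyEvalP1 f)^[m] ∞ = ∞ := fun m => Function.iterate_fixed rfl m
  ext x
  simp [fwdOrbit, this]

/-- An orbit of finite points avoiding finitely many points at the place `w` avoids them in the
chordal topology of the completion, together with the point at infinity. -/
theorem closure_fwdOrbit_inter_eq_empty {K : Type} [Field K] {w : PlaceK K} (C : CompletionOf w)
    (f : K[X]) (a : K) (V : Set (OnePoint K))
    (h : w.v.Avoids (Set.range fun m => (fun b => f.eval b)^[m] a) {v | (v : OnePoint K) ∈ V}) :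
    @closure _ (p1Top C.absv) (fwdOrbit (polyEvalP1 (f.map C.emb)) (mapPoint C.emb a)) ∩
      (mapPoint C.emb '' V) = ∅ := by
  obtain ⟨⟨B, hB⟩, hV⟩ := h
  rw [Set.eq_empty_iff_forall_notMem]
  rintro _ ⟨hcl, y, hy, rfl⟩
  revert hcl
  rw [imp_false, fwdOrbit_polyEvalP1_map_coe]
  have hB' : ∀ m, w.v ((fun b => f.eval b)^[m] a) ≤ B := fun m => hB _ ⟨m, rfl⟩
  have hmax : ∀ m, max 1 (w.v ((fun b => f.eval b)^[m] a)) ≤ max 1 B := fun m =>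
    max_le_max le_rfl (hB' m)
  have hpos : ∀ r : ℝ, 0 < max 1 r := fun r => lt_max_of_lt_left one_pos
  induction y using OnePoint.rec with
  | infty =>
    refine notMem_closure_p1Top _ (one_div_pos.2 (hpos B)) ?_
    rintro _ ⟨m, rfl⟩
    change _ ≤ 1 / max 1 (C.absv (C.emb _))
    rw [C.compat]
    exact one_div_le_one_div_of_le (hpos _) (hmax m)
  | coe v =>
    obtain ⟨ε, hε, h⟩ := hV v hy
    refine notMem_closure_p1Top _ (ε := ε / (max 1 (w.v v) * max 1 B))
      (div_pos hε (mul_pos (hpos _) (hpos _))) ?_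
    rintro _ ⟨m, rfl⟩
    change _ ≤ C.absv (C.emb v - C.emb _) / (max 1 (C.absv (C.emb v)) * max 1 (C.absv (C.emb _)))
    rw [← map_sub, C.compat, C.compat, C.compat, w.v.map_sub]
    exact div_le_div₀ (w.v.nonneg _) (h _ ⟨m, rfl⟩) (mul_pos (hpos _) (hpos _))
      (mul_le_mul_of_nonneg_left (hmax m) (hpos _).le)

theorem closure_fwdOrbit_infty_inter_eq_empty {K : Type} [Field K] {w : PlaceK K}
    (C : CompletionOf w) (f : K[X]) (V : Set (OnePoint K)) (hV : ∞ ∉ V) :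
    @closure _ (p1Top C.absv) (fwdOrbit (polyEvalP1 (f.map C.emb)) (mapPoint C.emb ∞)) ∩
      (mapPoint C.emb '' V) = ∅ := by
  rw [Set.eq_empty_iff_forall_notMem]
  rintro _ ⟨hcl, y, hy, rfl⟩
  revert hcl
  change _ ∉ @closure _ (p1Top C.absv) (fwdOrbit (polyEvalP1 (f.map C.emb)) ∞)
  rw [fwdOrbit_polyEvalP1_infty]
  induction y using OnePoint.rec with
  | infty => exact absurd hy hV
  | coe v =>
    refine notMem_closure_p1Top _ (ε := 1 / max 1 (C.absv (C.emb v)))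
      (one_div_pos.2 (lt_max_of_lt_left one_pos)) ?_
    rintro _ rfl
    exact le_rfl

/-- The absolute value `v` on `F` has finitely many extensions to `K` (with multiplicity), in terms
of which norms and traces can be expressed. -/
def AbsoluteValue.HasExtensions {F : Type} [Field F] (v : AbsoluteValue F ℝ) (K : Type) [Field K]
    [Algebra F K] : Prop :=
  ∃ (I : Type) (_ : Fintype I) (w : I → AbsoluteValue K ℝ),
    (∀ y, v (Algebra.norm F y) = ∏ i, w i y) ∧ ∀ y, v (Algebra.trace F K y) ≤ ∑ i, w i y

theorem AbsoluteValue.hasExtensions_of_isAlgClosed {F K Ω : Type} [Field F] [Field K] [Algebra F K]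
    [FiniteDimensional F K] [Algebra.IsSeparable F K] [Field Ω] [IsAlgClosed Ω] [Algebra F Ω]
    (v : AbsoluteValue F ℝ) (u : AbsoluteValue Ω ℝ) (h : ∀ x, u (algebraMap F Ω x) = v x) :
    v.HasExtensions K := by
  refine ⟨K →ₐ[F] Ω, inferInstance, fun σ => u.comp (f := (σ : K →+* Ω)) σ.injective,
    fun y => ?_, fun y => ?_⟩
  · rw [← h, Algebra.norm_eq_prod_embeddings, map_prod]
    rfl
  · rw [← h, trace_eq_sum_embeddings]
    exact u.sum_le _ _

theorem hasExtensions_abs_rat (K : Type) [Field K] [NumberField K] :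
    (Rat.AbsoluteValue.real).HasExtensions K :=
  AbsoluteValue.hasExtensions_of_isAlgClosed (Ω := ℂ) _ (NormedField.toAbsoluteValue ℂ)
    fun x => by
      change ‖(algebraMap ℚ ℂ x)‖ = _
      simp

theorem AbsoluteValue.hasExtensions_of_isNonarchimedean {F K : Type} [Field F] [Field K]
    [Algebra F K] [FiniteDimensional F K] [Algebra.IsSeparable F K] (v : AbsoluteValue F ℝ)
    (hv : IsNonarchimedean v) (x₀ : F) (hx₀ : 1 < v x₀) : v.HasExtensions K := by
  let C := v.Completion
  have hn : ∀ x : F, ‖((WithAbs.toAbs v x : WithAbs v) : C)‖ = v x := fun x =>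
    UniformSpace.Completion.norm_coe _
  let : NontriviallyNormedField C :=
    { (inferInstance : NormedField C) with
      non_trivial := ⟨((WithAbs.toAbs v x₀ : WithAbs v) : C), by rwa [hn]⟩ }
  have : IsUltrametricDist C := by
    refine IsUltrametricDist.isUltrametricDist_of_forall_norm_add_le_max_norm fun x y => ?_
    refine UniformSpace.Completion.induction_on₂ x y
      (isClosed_le (by fun_prop) (by fun_prop)) fun a b => ?_
    rw [← UniformSpace.Completion.coe_add, UniformSpace.Completion.norm_coe,
      UniformSpace.Completion.norm_coe, UniformSpace.Completion.norm_coe]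
    exact hv _ _
  let e : F →+* C := (UniformSpace.Completion.coeRingHom).comp
    ((WithAbs.equiv v).symm : F →+* WithAbs v)
  let : Algebra F (AlgebraicClosure C) := ((algebraMap C (AlgebraicClosure C)).comp e).toAlgebra
  let : NormedField (AlgebraicClosure C) := spectralNorm.normedField C (AlgebraicClosure C)
  refine AbsoluteValue.hasExtensions_of_isAlgClosed (Ω := AlgebraicClosure C) v
    (NormedField.toAbsoluteValue (AlgebraicClosure C)) fun x => ?_
  exact (spectralNorm_extends (e x)).trans (hn x)

section Dedekind

open IsDedekindDomain
open scoped NNReal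

variable {A K : Type} [CommRing A] [IsDedekindDomain A] [Field K] [Algebra A K] [IsFractionRing A K]

theorem IsDedekindDomain.HeightOneSpectrum.adicAbv_le_one_iff (p : HeightOneSpectrum A) {b : ℝ≥0}
    (hb : 1 < b) (x : K) : p.adicAbv hb x ≤ 1 ↔ p.valuation K x ≤ 1 := by
  change ((p.adicAbvDef hb x : ℝ≥0) : ℝ) ≤ 1 ↔ _
  rw [NNReal.coe_le_one]
  exact WithZeroMulInt.toNNReal_le_one_iff hb

theorem IsDedekindDomain.HeightOneSpectrum.finite_setOf_mem {s : A} (hs : s ≠ 0) :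
    {p : HeightOneSpectrum A | s ∈ p.asIdeal}.Finite := by
  have := Ideal.finite_factors (I := Ideal.span {s}) (by simpa using hs)
  simpa [Ideal.dvd_span_singleton] using this

/-- A family of elements that is integral away from `s` and has bounded denominators at the primes
dividing `s` becomes integral after multiplying with a fixed power of `s`. -/
theorem exists_pow_mul_mem_range {s : A} (hs : s ≠ 0) {b : HeightOneSpectrum A → ℝ≥0}
    (hb : ∀ p, 1 < b p) {X : Set K}
    (h1 : ∀ x ∈ X, ∀ p : HeightOneSpectrum A, s ∉ p.asIdeal → p.adicAbv (hb p) x ≤ 1)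
    (h2 : ∀ p : HeightOneSpectrum A, s ∈ p.asIdeal → ∃ B, ∀ x ∈ X, p.adicAbv (hb p) x ≤ B) :
    ∃ N : ℕ, ∀ x ∈ X, algebraMap A K s ^ N * x ∈ (algebraMap A K).range := by
  have h3 : ∀ p : HeightOneSpectrum A, s ∈ p.asIdeal →
      ∃ k : ℕ, ∀ x ∈ X, p.adicAbv (hb p) (algebraMap A K s ^ k * x) ≤ 1 := fun p hp => by
    obtain ⟨B, hB⟩ := h2 p hp
    have hlt := (p.adicAbv_coe_lt_one_iff (K := K) (hb p) s).2 hp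
    obtain ⟨k, hk⟩ := exists_pow_lt_of_lt_one (show (0 : ℝ) < 1 / (max 1 B) by positivity) hlt
    refine ⟨k, fun x hx => ?_⟩
    rw [map_mul, map_pow]
    calc _ ≤ 1 / (max 1 B) * max 1 B :=
          mul_le_mul hk.le ((hB x hx).trans (le_max_right _ _)) ((p.adicAbv (hb p)).nonneg _)
            (by positivity)
      _ = 1 := one_div_mul_cancel (by positivity)
  choose! k hk using h3
  let N := (HeightOneSpectrum.finite_setOf_mem hs).toFinset.sup k
  refine ⟨N, fun x hx => HeightOneSpectrum.mem_integers_of_valuation_le_one K _ fun p => ?_⟩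
  rw [← p.adicAbv_le_one_iff (hb p)]
  have hinteg : ∀ n : ℕ, p.adicAbv (hb p) (algebraMap A K s ^ n) ≤ 1 := fun n => by
    rw [← map_pow]
    exact p.adicAbv_coe_le_one (hb p) _
  by_cases hp : s ∈ p.asIdeal
  · have hkN : k p ≤ N := Finset.le_sup (f := k) (by simpa using hp)
    rw [← Nat.sub_add_cancel hkN, pow_add, mul_assoc, map_mul]
    exact mul_le_one₀ (hinteg _) ((p.adicAbv (hb p)).nonneg _) (hk p hp x hx)
  · rw [map_mul]
    exact mul_le_one₀ (hinteg _) ((p.adicAbv (hb p)).nonneg _) (h1 x hx p hp)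

theorem finite_setOf_adicAbv_ne_one {b : HeightOneSpectrum A → ℝ≥0} (hb : ∀ p, 1 < b p) {x : K}
    (hx : x ≠ 0) : {p : HeightOneSpectrum A | p.adicAbv (hb p) x ≠ 1}.Finite := by
  refine ((HeightOneSpectrum.Support.finite A x).union
    (HeightOneSpectrum.Support.finite A x⁻¹)).subset fun p hp => ?_
  by_contra! h
  have h1 : p.adicAbv (hb p) x ≤ 1 := by
    rw [p.adicAbv_le_one_iff]; exact not_lt.1 fun h' => h (Or.inl h')
  have h2 : p.adicAbv (hb p) x⁻¹ ≤ 1 := by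
    rw [p.adicAbv_le_one_iff]; exact not_lt.1 fun h' => h (Or.inr h')
  rw [map_inv₀] at h2
  exact hp (h1.antisymm ((inv_le_one₀ ((p.adicAbv (hb p)).pos hx)).1 h2))

theorem finite_setOf_not_adicAbv_le_one {b : HeightOneSpectrum A → ℝ≥0} (hb : ∀ p, 1 < b p)
    (x : K) : {p : HeightOneSpectrum A | ¬ p.adicAbv (hb p) x ≤ 1}.Finite := by
  rcases eq_or_ne x 0 with rfl | hx
  · simp
  · exact (finite_setOf_adicAbv_ne_one hb hx).subset fun p hp h => hp h.le

/-- A product formula for the divisors of powers of a fixed element `s` of a principal ideal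
domain. -/
theorem exists_mul_prod_adicAbv_eq_one {R F : Type} [CommRing R] [IsDomain R]
    [IsPrincipalIdealRing R] [Field F] [Algebra R F] [IsFractionRing R F] (v : AbsoluteValue F ℝ)
    (hu : ∀ r : R, IsUnit r → v (algebraMap R F r) = 1)
    (hn : ∀ r : R, r ≠ 0 → ¬ IsUnit r → 1 < v (algebraMap R F r)) {s : R} (hs : s ≠ 0)
    [Fintype {P : HeightOneSpectrum R // s ∈ P.asIdeal}] :
    ∃ (b : HeightOneSpectrum R → ℝ≥0) (hb : ∀ P, 1 < b P), ∀ (n : ℕ) (r : R), r ∣ s ^ n →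
      v (algebraMap R F r) * ∏ P : {P : HeightOneSpectrum R // s ∈ P.asIdeal},
        P.1.adicAbv (hb P) (algebraMap R F r) = 1 := by
  classical
  have hgen : ∀ P : HeightOneSpectrum R, ∃ π : R, P.asIdeal = Ideal.span {π} := fun P =>
    (IsPrincipalIdealRing.principal P.asIdeal).principal
  choose π hπ using hgen
  have hπ0 : ∀ P, π P ≠ 0 := fun P h => P.ne_bot (by rw [hπ, h, Ideal.span_singleton_eq_bot])
  have hπu : ∀ P, ¬ IsUnit (π P) := fun P h =>
    P.isPrime.ne_top (by rw [hπ, Ideal.span_singleton_eq_top]; exact h)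
  let b : HeightOneSpectrum R → ℝ≥0 := fun P => ⟨v (algebraMap R F (π P)), v.nonneg _⟩
  have hb : ∀ P, 1 < b P := fun P => hn _ (hπ0 P) (hπu P)
  refine ⟨b, hb, fun n r => ?_⟩
  induction r using UniqueFactorizationMonoid.induction_on_prime with
  | h₁ => exact fun h => absurd (zero_dvd_iff.1 h) (pow_ne_zero _ hs)
  | h₂ r hr =>
    intro _
    rw [hu r hr, one_mul]
    refine Finset.prod_eq_one fun P _ => (P.1.adicAbv_coe_eq_one_iff _ r).2 fun h => ?_
    exact P.1.isPrime.ne_top (Ideal.eq_top_of_isUnit_mem _ h hr)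
  | h₃ a p ha hp ih =>
    intro hdvd
    have hps : p ∣ s := hp.dvd_of_dvd_pow ((dvd_mul_right _ _).trans hdvd)
    let P : HeightOneSpectrum R := ⟨Ideal.span {p}, (Ideal.span_singleton_prime hp.ne_zero).2 hp,
      by simpa using hp.ne_zero⟩
    have hsP : s ∈ P.asIdeal := Ideal.mem_span_singleton.2 hps
    have hvp : v (algebraMap R F (π P)) = v (algebraMap R F p) := by
      obtain ⟨u, hu'⟩ := Ideal.span_singleton_eq_span_singleton.1 (hπ P)
      rw [← hu', map_mul, map_mul, hu _ u.isUnit, mul_one]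
    have key : v (algebraMap R F p) * ∏ Q : {P : HeightOneSpectrum R // s ∈ P.asIdeal},
        Q.1.adicAbv (hb Q.1) (algebraMap R F p) = 1 := by
      rw [Finset.prod_eq_single (⟨P, hsP⟩ : {P : HeightOneSpectrum R // s ∈ P.asIdeal})]
      · change _ * ((WithZeroMulInt.toNNReal (ne_zero_of_lt (hb P)) (P.valuation F (algebraMap R F p)) : ℝ≥0) : ℝ) = 1
        rw [P.valuation_of_algebraMap, P.intValuation_singleton hp.ne_zero rfl,
          WithZeroMulInt.toNNReal_neg_apply _ WithZero.exp_ne_zero]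
        change _ * ((b P ^ (-1 : ℤ) : ℝ≥0) : ℝ) = 1
        rw [zpow_neg_one, NNReal.coe_inv]
        change _ * (v (algebraMap R F (π P)))⁻¹ = 1
        rw [hvp]
        exact mul_inv_cancel₀ (zero_lt_one.trans (hvp ▸ hn _ (hπ0 P) (hπu P))).ne'
      · intro Q _ hQ
        refine (Q.1.adicAbv_coe_eq_one_iff _ p).2 fun h => hQ (Subtype.ext ?_)
        exact HeightOneSpectrum.ext (P.isMaximal.eq_of_le Q.1.isPrime.ne_top
          ((Ideal.span_singleton_le_iff_mem _).2 h)).symm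
      · exact fun h => absurd (Finset.mem_univ _) h
    rw [map_mul]
    simp only [map_mul, Finset.prod_mul_distrib]
    rw [mul_mul_mul_comm, key, one_mul]
    exact ih ((dvd_mul_left _ _).trans hdvd)

end Dedekind

section Nonarchimedean

variable {K : Type} [Field K] {w : AbsoluteValue K ℝ}

/-- The ring of integers of a non-archimedean absolute value. -/
def AbsoluteValue.integerSubring (w : AbsoluteValue K ℝ) (hw : IsNonarchimedean w) :
    Subring K where
  carrier := {x | w x ≤ 1}
  mul_mem' ha hb := by
    change w _ ≤ 1
    rw [map_mul]
    exact mul_le_one₀ ha (w.nonneg _) hb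
  one_mem' := w.map_one.le
  add_mem' ha hb := (hw _ _).trans (max_le ha hb)
  zero_mem' := w.map_zero.trans_le zero_le_one
  neg_mem' ha := (w.map_neg _).trans_le ha

theorem IsNonarchimedean.apply_eval_le_one (hw : IsNonarchimedean w) {f : K[X]}
    (hf : ∀ n, w (f.coeff n) ≤ 1) {x : K} (hx : w x ≤ 1) : w (f.eval x) ≤ 1 := by
  change f.eval x ∈ w.integerSubring hw
  rw [eval_eq_sum]
  exact sum_mem fun n _ => mul_mem (hf n) (pow_mem hx n)

theorem IsNonarchimedean.apply_eval_sub_eval_le (hw : IsNonarchimedean w) {f : K[X]}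
    (hf : ∀ n, w (f.coeff n) ≤ 1) {x y : K} (hx : w x ≤ 1) (hy : w y ≤ 1) :
    w (f.eval x - f.eval y) ≤ w (x - y) := by
  have : ∃ z ∈ w.integerSubring hw, f.eval x - f.eval y = (x - y) * z := by
    rw [eval_eq_sum, eval_eq_sum, Polynomial.sum, Polynomial.sum, ← Finset.sum_sub_distrib]
    refine ⟨∑ n ∈ f.support, f.coeff n * ∑ i ∈ Finset.range n, x ^ i * y ^ (n - 1 - i),
      sum_mem fun n _ => mul_mem (hf n) (sum_mem fun i _ => mul_mem (pow_mem hx _) (pow_mem hy _)),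
      ?_⟩
    rw [Finset.mul_sum]
    refine Finset.sum_congr rfl fun n _ => ?_
    rw [← mul_sub, ← Commute.mul_geom_sum₂ (Commute.all x y)]
    ring
  obtain ⟨z, hz, h⟩ := this
  rw [h, map_mul]
  exact mul_le_of_le_one_right (w.nonneg _) hz

/-- If `g` divides `g ∘ f` with integral cofactor and `g` takes a non-unit value on an integral
orbit, then the orbit avoids all points at which `g` takes unit values. -/
theorem IsNonarchimedean.avoids_of_apply_eval_lt_one (hw : IsNonarchimedean w) {f g q : K[X]}
    (hf : ∀ n, w (f.coeff n) ≤ 1) (hg : ∀ n, w (g.coeff n) ≤ 1) (hq : ∀ n, w (q.coeff n) ≤ 1)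
    (hgf : g.comp f = g * q) {x : ℕ → K} (hx : ∀ m, x (m + 1) = f.eval (x m)) (hx0 : w (x 0) ≤ 1)
    {V : Set K} (hV : ∀ v ∈ V, w v ≤ 1 ∧ w (g.eval v) = 1) (hxV : ∀ m, x m ∉ V) {m₀ : ℕ}
    (hm₀ : w (g.eval (x m₀)) < 1) : w.Avoids (Set.range x) V := by
  have hxi : ∀ m, w (x m) ≤ 1 := fun m => by
    induction m with
    | zero => exact hx0
    | succ m ih => rw [hx]; exact hw.apply_eval_le_one hf ih
  refine ⟨⟨1, ?_⟩, fun v hv => ?_⟩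
  · rintro _ ⟨m, rfl⟩
    exact hxi m
  have hlt : ∀ m ≥ m₀, w (g.eval (x m)) < 1 := fun m hm => by
    induction m, hm using Nat.le_induction with
    | base => exact hm₀
    | succ m _ ih =>
      rw [hx, ← eval_comp, hgf, eval_mul, map_mul]
      exact mul_lt_one_of_nonneg_of_lt_one_left (w.nonneg _) ih (hw.apply_eval_le_one hq (hxi m))
  have hfar : ∀ m ≥ m₀, 1 ≤ w (x m - v) := fun m hm => by
    by_contra! h
    have h1 := (hw.apply_eval_sub_eval_le hg (hxi m) (hV v hv).1).trans_lt h
    have h2 := hw (g.eval (x m)) (-(g.eval (x m) - g.eval v))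
    rw [w.map_neg, neg_sub, add_sub_cancel, (hV v hv).2] at h2
    exact absurd h2 (not_le.2 (max_lt (hlt m hm) h1))
  obtain ⟨ε, hε, h⟩ : ∃ ε > 0, ∀ m < m₀, ε ≤ w (x m - v) := by
    have hpos : ∀ m, 0 < w (x m - v) := fun m =>
      w.pos (sub_ne_zero.2 fun h => hxV m (h ▸ hv))
    clear hm₀ hlt hfar
    induction m₀ with
    | zero => exact ⟨1, one_pos, by simp⟩
    | succ k ih =>
      obtain ⟨ε, hε, h⟩ := ih
      refine ⟨min ε (w (x k - v)), lt_min hε (hpos k), fun m hm => ?_⟩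
      rcases Nat.lt_succ_iff_lt_or_eq.1 hm with hm | rfl
      · exact (min_le_left _ _).trans (h m hm)
      · exact min_le_right _ _
  refine ⟨min 1 ε, lt_min one_pos hε, ?_⟩
  rintro _ ⟨m, rfl⟩
  rcases lt_or_ge m m₀ with hm | hm
  · exact (min_le_right _ _).trans (h m hm)
  · exact (min_le_left _ _).trans (hfar m hm)

end Nonarchimedean

section Arithmetic

open IsDedekindDomain
open scoped NNReal

/-- If an absolute value exceeds `1` on nonunits and is `1` on units, no nonunit is divisible by all
primes of an integral extension. -/
theorem exists_algebraMap_notMem_asIdeal {R A F : Type} [CommRing R] [IsDomain R] [CommRing A]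
    [IsDedekindDomain A] [Algebra R A] [Algebra.IsIntegral R A] [FaithfulSMul R A] [Field F]
    [Algebra R F] (v : AbsoluteValue F ℝ)
    (hu : ∀ r : R, IsUnit r → v (algebraMap R F r) = 1)
    (hn : ∀ r : R, r ≠ 0 → ¬ IsUnit r → 1 < v (algebraMap R F r)) {s : R} (hs : s ≠ 0)
    (hsu : ¬ IsUnit s) : ∃ p : HeightOneSpectrum A, algebraMap R A s ∉ p.asIdeal := by
  by_contra! h
  obtain ⟨k, hk⟩ := pow_unbounded_of_one_lt 2 (hn s hs hsu)
  have hk0 : k ≠ 0 := by rintro rfl; norm_num at hk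
  have hne : 1 + s ^ k ≠ 0 := fun h0 => by
    rw [← map_pow, ← map_pow, eq_neg_of_add_eq_zero_right h0, map_neg, v.map_neg, map_one, v.map_one] at hk
    norm_num at hk
  have : IsUnit (algebraMap R A (1 + s ^ k)) := by
    by_contra hun
    obtain ⟨M, hM, hmem⟩ := exists_max_ideal_of_mem_nonunits hun
    let p : HeightOneSpectrum A := ⟨M, hM.isPrime, fun hbot => hne (by
      rw [hbot, Ideal.mem_bot] at hmem
      exact (map_eq_zero_iff _ (FaithfulSMul.algebraMap_injective R A)).1 hmem)⟩
    have h1 : algebraMap R A s ^ k ∈ M := Ideal.pow_mem_of_mem _ (h p) _ (Nat.pos_of_ne_zero hk0)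
    rw [map_add, map_one, map_pow] at hmem
    exact hM.ne_top ((Ideal.eq_top_iff_one _).2 ((Submodule.add_mem_iff_left _ h1).1 hmem))
  have hunit := (Algebra.IsIntegral.isLocalHom R A).map_nonunit _ this
  have h1 := hu _ hunit
  rw [map_add, map_one, map_pow] at h1
  have h2 := v.sub_le_add (1 + algebraMap R F s ^ k) 1
  rw [add_sub_cancel_left, h1, map_one, map_pow] at h2
  linarith

/-- Finitely many primes of an integral extension of `R` contain a common nonunit of `R`. -/
theorem exists_algebraMap_mem_asIdeal {R A : Type} [CommRing R] [IsDomain R] [CommRing A]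
    [IsDedekindDomain A] [Algebra R A] [Algebra.IsIntegral R A] {r : R} (hr : r ≠ 0)
    (hru : ¬ IsUnit r) {S : Set (HeightOneSpectrum A)} (hS : S.Finite) :
    ∃ s : R, s ≠ 0 ∧ ¬ IsUnit s ∧ ∀ p ∈ S, algebraMap R A s ∈ p.asIdeal := by
  induction S, hS using Set.Finite.induction_on with
  | empty => exact ⟨r, hr, hru, by simp⟩
  | @insert p S _ _ ih =>
    obtain ⟨s, hs, hsu, h⟩ := ih
    obtain ⟨t, ht, ht0⟩ := (Submodule.ne_bot_iff _).1
      (Ideal.IsIntegral.comap_ne_bot (R := R) p.ne_bot)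
    refine ⟨t * s, mul_ne_zero ht0 hs, fun hu => hsu (isUnit_of_mul_isUnit_right hu), ?_⟩
    rintro q (rfl | hq) <;> rw [map_mul]
    · exact Ideal.mul_mem_right _ _ ht
    · exact Ideal.mul_mem_left _ _ (h q hq)

theorem isIntegral_of_mem_range_algebraMap {R A K : Type} [CommRing R] [CommRing A] [Algebra R A]
    [Algebra.IsIntegral R A] [CommRing K] [Algebra A K] [Algebra R K] [IsScalarTower R A K] {y : K}
    (hy : y ∈ (algebraMap A K).range) : IsIntegral R y := by
  obtain ⟨z, rfl⟩ := hy
  exact (Algebra.IsIntegral.isIntegral (R := R) z).algebraMap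

/-- The norm of an `S`-unit is an `S`-unit. -/
theorem exists_dvd_pow_algebraMap_eq_norm {R F A K : Type} [CommRing R] [IsDomain R]
    [IsPrincipalIdealRing R] [Field F] [Algebra R F] [IsFractionRing R F] [CommRing A] [Algebra R A]
    [Algebra.IsIntegral R A] [Field K] [Algebra A K] [Algebra R K] [IsScalarTower R A K]
    [Algebra F K] [IsScalarTower R F K] [FiniteDimensional F K] {s : R} {y : K} (hy : y ≠ 0) {n : ℕ}
    (h1 : algebraMap A K (algebraMap R A s) ^ n * y ∈ (algebraMap A K).range)
    (h2 : algebraMap A K (algebraMap R A s) ^ n * y⁻¹ ∈ (algebraMap A K).range) :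
    ∃ (r : R) (k l : ℕ), r ∣ s ^ k ∧
      algebraMap R F r = algebraMap R F s ^ l * Algebra.norm F y := by
  obtain ⟨r₁, hr₁⟩ := IsIntegrallyClosed.isIntegral_iff.1
    (Algebra.isIntegral_norm F (isIntegral_of_mem_range_algebraMap (R := R) h1))
  obtain ⟨r₂, hr₂⟩ := IsIntegrallyClosed.isIntegral_iff.1
    (Algebra.isIntegral_norm F (isIntegral_of_mem_range_algebraMap (R := R) h2))
  have hs : algebraMap A K (algebraMap R A s) = algebraMap F K (algebraMap R F s) := by
    rw [← IsScalarTower.algebraMap_apply, ← IsScalarTower.algebraMap_apply]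
  rw [hs, map_mul, map_pow, Algebra.norm_algebraMap, ← pow_mul] at hr₁ hr₂
  refine ⟨r₁, Module.finrank F K * n + Module.finrank F K * n, Module.finrank F K * n, ⟨r₂, ?_⟩, hr₁⟩
  apply IsFractionRing.injective R F
  have hN : Algebra.norm F y * Algebra.norm F y⁻¹ = 1 := by
    rw [← map_mul, mul_inv_cancel₀ hy, map_one]
  rw [map_mul, hr₁, hr₂, map_pow, pow_add]
  linear_combination (-(algebraMap R F s ^ (Module.finrank F K * n)) ^ 2) * hN

end Arithmetic

section Arithmetic

open IsDedekindDomain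
open scoped NNReal

theorem algebraMap_ne_zero_of_isScalarTower {R A : Type} (F K : Type) [CommRing R] [IsDomain R]
    [Field F] [Algebra R F] [IsFractionRing R F] [CommRing A] [Algebra R A] [Field K] [Algebra A K]
    [Algebra R K] [IsScalarTower R A K] [Algebra F K] [IsScalarTower R F K] {s : R} (hs : s ≠ 0) :
    algebraMap R A s ≠ 0 := fun h => by
  have h1 : algebraMap F K (algebraMap R F s) ≠ 0 :=
    (_root_.map_ne_zero _).2 ((map_ne_zero_iff _ (IsFractionRing.injective R F)).2 hs)
  rw [← IsScalarTower.algebraMap_apply, IsScalarTower.algebraMap_apply R A K, h, map_zero] at h1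
  exact h1 rfl

variable {R F A K : Type} [CommRing R] [IsDomain R] [IsPrincipalIdealRing R] [Field F] [Algebra R F]
  [IsFractionRing R F] [CommRing A] [IsDedekindDomain A] [Algebra R A] [Algebra.IsIntegral R A]
  [Field K] [Algebra A K] [IsFractionRing A K] [Algebra R K] [IsScalarTower R A K]
  [Algebra F K] [IsScalarTower R F K] [FiniteDimensional F K] [Algebra.IsSeparable F K]

/-- If `g` divides `g ∘ f` with coprime cofactor and takes `S`-unit values along an orbit of `f`,
then all traces of the orbit are bounded at the places in `S`. -/
theorem exists_trace_orbit_le (v : AbsoluteValue F ℝ)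
    (hu : ∀ r : R, IsUnit r → v (algebraMap R F r) = 1)
    (hn : ∀ r : R, r ≠ 0 → ¬ IsUnit r → 1 < v (algebraMap R F r)) (hv : v.HasExtensions K) {s : R}
    (hs : s ≠ 0) {b : HeightOneSpectrum A → ℝ≥0} (hb : ∀ p, 1 < b p) {f g q : K[X]}
    (hf : 2 ≤ f.natDegree) (hg : 1 ≤ g.natDegree) (hgf : g.comp f = g * q) (hgq : IsCoprime g q)
    {x : ℕ → K} (hx : ∀ m, x (m + 1) = f.eval (x m)) (hx0 : ∀ m, g.eval (x m) ≠ 0)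
    (hunit : ∀ m, ∀ p : HeightOneSpectrum A, algebraMap R A s ∉ p.asIdeal →
      p.adicAbv (hb p) (g.eval (x m)) = 1) :
    ∃ (c : HeightOneSpectrum R → ℝ≥0) (hc : ∀ P, 1 < c P), ∀ y : K,
      (∃ B, ∀ m, v (Algebra.trace F K (x m * y)) ≤ B) ∧
      ∀ P : HeightOneSpectrum R, s ∈ P.asIdeal →
        ∃ B, ∀ m, P.adicAbv (hc P) (Algebra.trace F K (x m * y)) ≤ B := by
  classical
  let T := {P : HeightOneSpectrum R // s ∈ P.asIdeal}
  have : Fintype T := (HeightOneSpectrum.finite_setOf_mem hs).fintype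
  obtain ⟨c, hc, hprod⟩ := exists_mul_prod_adicAbv_eq_one v hu hn hs
  refine ⟨c, hc, ?_⟩
  let u : Option T → AbsoluteValue F ℝ := fun o => o.elim v fun P => P.1.adicAbv (hc P.1)
  have hext : ∀ o, (u o).HasExtensions K := by
    rintro (_ | P)
    · exact hv
    · refine AbsoluteValue.hasExtensions_of_isNonarchimedean _ (P.1.isNonarchimedean_adicAbv _)
        (algebraMap R F s)⁻¹ ?_
      rw [map_inv₀]
      refine (one_lt_inv₀ ((P.1.adicAbv (hc P.1)).pos ?_)).2
        ((P.1.adicAbv_coe_lt_one_iff (hc P.1) s).2 P.2)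
      exact (map_ne_zero_iff _ (IsFractionRing.injective R F)).2 hs
  choose I hI w hnorm htrace using hext
  have hprod' : ∀ (n : ℕ) (r : R), r ∣ s ^ n → ∏ o, u o (algebraMap R F r) = 1 := fun n r h => by
    rw [Fintype.prod_option]
    exact hprod n r h
  have hA := algebraMap_ne_zero_of_isScalarTower (A := A) F K hs
  have hbdd := orbit_bounded_of_prod_eq_one (fun i : (Σ o, I o) => w i.1 i.2) f g q hf hg hgf hgq x
    hx hx0 fun m => by
      have hinv : ∀ p : HeightOneSpectrum A, algebraMap R A s ∉ p.asIdeal →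
          p.adicAbv (hb p) (g.eval (x m))⁻¹ = 1 := fun p hp => by
        rw [map_inv₀, hunit m p hp, inv_one]
      obtain ⟨N, hN⟩ := exists_pow_mul_mem_range (K := K) hA hb
        (X := {g.eval (x m), (g.eval (x m))⁻¹})
        (by rintro _ (rfl | rfl) p hp; exacts [(hunit m p hp).le, (hinv p hp).le])
        (fun p _ => ⟨max (p.adicAbv (hb p) (g.eval (x m))) (p.adicAbv (hb p) (g.eval (x m))⁻¹), by
          rintro _ (rfl | rfl); exacts [le_max_left _ _, le_max_right _ _]⟩)
      obtain ⟨r, k, l, hr, hrl⟩ := exists_dvd_pow_algebraMap_eq_norm (R := R) (F := F) (hx0 m)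
        (hN _ (Or.inl rfl)) (hN _ (Or.inr rfl))
      have h1 := hprod' k r hr
      have h2 := hprod' l (s ^ l) dvd_rfl
      rw [hrl] at h1
      simp only [map_mul, Finset.prod_mul_distrib] at h1
      rw [map_pow] at h2
      rw [h2, one_mul] at h1
      rw [Fintype.prod_sigma]
      exact (Finset.prod_congr rfl fun o _ => (hnorm o _).symm).trans h1
  have hall : ∀ o (y : K), ∃ B, ∀ m, u o (Algebra.trace F K (x m * y)) ≤ B := fun o y => by
    choose B hB using fun i : I o => hbdd ⟨o, i⟩
    refine ⟨∑ i, B i * w o i y, fun m => (htrace o _).trans (Finset.sum_le_sum fun i _ => ?_)⟩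
    rw [map_mul]
    exact mul_le_mul_of_nonneg_right (hB i m) ((w o i).nonneg _)
  exact fun y => ⟨hall none y, fun P hP => hall (Option.some ⟨P, hP⟩) y⟩

/-- In the situation of `exists_trace_orbit_le`, the orbit has integral coordinates of bounded size
with respect to a suitable basis. -/
theorem exists_integral_coordinates (v : AbsoluteValue F ℝ)
    (hu : ∀ r : R, IsUnit r → v (algebraMap R F r) = 1)
    (hn : ∀ r : R, r ≠ 0 → ¬ IsUnit r → 1 < v (algebraMap R F r)) (hv : v.HasExtensions K) {s : R}
    (hs : s ≠ 0) {b : HeightOneSpectrum A → ℝ≥0} (hb : ∀ p, 1 < b p) {f g q : K[X]}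
    (hf : 2 ≤ f.natDegree) (hg : 1 ≤ g.natDegree) (hgf : g.comp f = g * q) (hgq : IsCoprime g q)
    {x : ℕ → K} (hx : ∀ m, x (m + 1) = f.eval (x m)) (hx0 : ∀ m, g.eval (x m) ≠ 0)
    (hinteg : ∀ m, ∀ p : HeightOneSpectrum A, algebraMap R A s ∉ p.asIdeal →
      p.adicAbv (hb p) (x m) ≤ 1)
    (hunit : ∀ m, ∀ p : HeightOneSpectrum A, algebraMap R A s ∉ p.asIdeal →
      p.adicAbv (hb p) (g.eval (x m)) = 1) :
    ∃ (ι : Type) (_ : Fintype ι) (e : ι → K) (B : ℝ), ∀ m, ∃ c : ι → R,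
      (∀ j, v (algebraMap R F (c j)) ≤ B) ∧ x m = ∑ j, algebraMap R K (c j) * e j := by
  classical
  obtain ⟨c, hc, htr⟩ := exists_trace_orbit_le v hu hn hv hs hb hf hg hgf hgq hx hx0 hunit
  obtain ⟨ι, β, hβ⟩ := FiniteDimensional.exists_is_basis_integral R F K
  have hA := algebraMap_ne_zero_of_isScalarTower (A := A) F K hs
  have hF : algebraMap R F s ≠ 0 := (map_ne_zero_iff _ (IsFractionRing.injective R F)).2 hs
  -- The coordinates are integral away from `s`.
  have hcoord : ∀ m (j : ι), ∀ P : HeightOneSpectrum R, s ∉ P.asIdeal →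
      P.adicAbv (hc P) (Algebra.trace F K (x m * β j)) ≤ 1 := fun m j P hP => by
    obtain ⟨N, hN⟩ := exists_pow_mul_mem_range (K := K) hA hb (X := {x m})
      (by rintro _ rfl; exact hinteg m) (fun p _ => ⟨_, by rintro _ rfl; exact le_rfl⟩)
    have h1 := (isIntegral_of_mem_range_algebraMap (R := R) (hN _ rfl)).mul (hβ j)
    have h2 : algebraMap A K (algebraMap R A s) ^ N * x m * β j =
        (algebraMap R F s ^ N) • (x m * β j) := by
      rw [Algebra.smul_def, map_pow, ← IsScalarTower.algebraMap_apply,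
        ← IsScalarTower.algebraMap_apply, mul_assoc]
    rw [h2] at h1
    obtain ⟨r, hr⟩ := IsIntegrallyClosed.isIntegral_iff.1 (Algebra.isIntegral_trace (L := F) h1)
    have h3 := P.adicAbv_coe_le_one (K := F) (hc P) r
    rwa [hr, _root_.map_smul, smul_eq_mul, map_mul, map_pow, (P.adicAbv_coe_eq_one_iff (hc P) s).2 hP,
      one_pow, one_mul] at h3
  choose hBv hBP using htr
  choose B₀ hB₀ using fun j : ι => hBv (β j)
  obtain ⟨N, hN⟩ := exists_pow_mul_mem_range (K := F) hs hc
    (X := Set.range fun i : ℕ × ι => Algebra.trace F K (x i.1 * β i.2))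
    (by rintro _ ⟨i, rfl⟩; exact hcoord i.1 i.2) fun P hP => by
      choose B hB using fun j : ι => hBP (β j) P hP
      refine ⟨∑ j, |B j|, ?_⟩
      rintro _ ⟨i, rfl⟩
      exact ((hB i.2 i.1).trans (le_abs_self _)).trans
        (Finset.single_le_sum (f := fun j => |B j|) (fun j _ => abs_nonneg _) (Finset.mem_univ i.2))
  refine ⟨ι, inferInstance, fun j => (algebraMap R K s ^ N)⁻¹ * β.traceDual j,
    ∑ j, v (algebraMap R F s ^ N) * |B₀ j|, fun m => ?_⟩
  choose r hr using fun j : ι => hN _ ⟨(m, j), rfl⟩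
  refine ⟨r, fun j => ?_, ?_⟩
  · rw [hr, map_mul]
    exact (mul_le_mul_of_nonneg_left ((hB₀ j m).trans (le_abs_self _)) (v.nonneg _)).trans
      (Finset.single_le_sum (f := fun j => v (algebraMap R F s ^ N) * |B₀ j|)
        (fun j _ => by positivity) (Finset.mem_univ j))
  · conv_lhs => rw [← β.traceDual.sum_repr (x m)]
    refine Finset.sum_congr rfl fun j _ => ?_
    have hsK : algebraMap R K s ≠ 0 := by
      rw [IsScalarTower.algebraMap_apply R F K]
      exact (_root_.map_ne_zero _).2 hF
    rw [Module.Basis.traceDual_repr_apply, Algebra.traceForm_apply, Algebra.smul_def,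
      IsScalarTower.algebraMap_apply R F K (r j), hr,
      map_mul (algebraMap F K), map_pow, ← IsScalarTower.algebraMap_apply]
    field_simp

end Arithmetic

section Arithmetic

open IsDedekindDomain
open scoped NNReal

theorem infinite_setOf_avoids_range {R F A K : Type} [CommRing R] [IsDomain R]
    [IsPrincipalIdealRing R] [Field F] [Algebra R F] [IsFractionRing R F] [CommRing A]
    [IsDedekindDomain A] [Algebra R A] [Algebra.IsIntegral R A] [Field K] [Algebra A K]
    [IsFractionRing A K] [Algebra R K] [IsScalarTower R A K] [Algebra F K] [IsScalarTower R F K]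
    [FiniteDimensional F K] [CharZero K] (v : AbsoluteValue F ℝ)
    (hu : ∀ r : R, IsUnit r → v (algebraMap R F r) = 1)
    (hn : ∀ r : R, r ≠ 0 → ¬ IsUnit r → 1 < v (algebraMap R F r)) (hv : v.HasExtensions K)
    (hR : ∃ r : R, r ≠ 0 ∧ ¬ IsUnit r) {b : HeightOneSpectrum A → ℝ≥0} (hb : ∀ p, 1 < b p)
    (hdisc : ∀ (ι : Type) [Fintype ι] (e : ι → K) (B : ℝ) (Y : Set K), (∀ y ∈ Y, ∃ c : ι → R,
      (∀ j, v (algebraMap R F (c j)) ≤ B) ∧ y = ∑ j, algebraMap R K (c j) * e j) →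
      ∀ p : HeightOneSpectrum A, (p.adicAbv (K := K) (hb p)).Avoids Y Yᶜ)
    {f : K[X]} (hf : 2 ≤ f.natDegree) {x : ℕ → K} (hx : ∀ m, x (m + 1) = f.eval (x m)) {V : Set K}
    (hV : V.Finite) (hxV : ∀ m, x m ∉ V) :
    {p : HeightOneSpectrum A | (p.adicAbv (K := K) (hb p)).Avoids (Set.range x) V}.Infinite := by
  have : CharZero F := (algebraMap F K).charZero
  have hcompl : V ⊆ (Set.range x)ᶜ := by
    rintro _ hv' ⟨m, rfl⟩
    exact hxV m hv'
  have : FaithfulSMul R A := (faithfulSMul_iff_algebraMap_injective R A).2 <| by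
    rw [injective_iff_map_eq_zero]
    exact fun s hs => by_contra fun h => algebraMap_ne_zero_of_isScalarTower (A := A) F K h hs
  intro hfin
  obtain ⟨g, q, hg, hgf, hgq, hgV⟩ := exists_coprime_comp_factor f hf hV.toFinset
  have hinteg : ∀ Z : Set K, Z.Finite →
      {p : HeightOneSpectrum A | ∃ z ∈ Z, ¬ p.adicAbv (hb p) z ≤ 1}.Finite := fun Z hZ =>
    (hZ.biUnion fun z _ => finite_setOf_not_adicAbv_le_one hb z).subset fun p ⟨z, hz, h⟩ =>
      Set.mem_biUnion hz h
  have hunit : {p : HeightOneSpectrum A | ∃ v ∈ V, p.adicAbv (hb p) (g.eval v) ≠ 1}.Finite :=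
    (hV.biUnion fun v hv => finite_setOf_adicAbv_ne_one hb (hgV v (hV.mem_toFinset.2 hv))).subset
      fun p ⟨z, hz, h⟩ => Set.mem_biUnion hz h
  have hcoeff : ∀ h : K[X], (Set.range h.coeff).Finite := fun h =>
    ((h.coeffs.finite_toSet).insert 0).subset <| by
      rintro _ ⟨n, rfl⟩
      by_cases hn : h.coeff n = 0
      · exact Or.inl hn
      · exact Or.inr (Finset.mem_coe.2 (coeff_mem_coeffs hn))
  obtain ⟨r₀, hr₀, hr₀u⟩ := hR
  obtain ⟨s, hs, hsu, hmem⟩ := exists_algebraMap_mem_asIdeal hr₀ hr₀u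
    ((hfin.union hunit).union (hinteg (Set.range f.coeff ∪ Set.range g.coeff ∪ Set.range q.coeff ∪
      V ∪ {x 0}) (((((hcoeff f).union (hcoeff g)).union (hcoeff q)).union hV).union
        (Set.finite_singleton _))))
  have hgood : ∀ p : HeightOneSpectrum A, algebraMap R A s ∉ p.asIdeal →
      ¬ (p.adicAbv (K := K) (hb p)).Avoids (Set.range x) V ∧
      (∀ m, p.adicAbv (hb p) (x m) ≤ 1) ∧ ∀ m, p.adicAbv (hb p) (g.eval (x m)) = 1 := fun p hp => by
    have h := mt (hmem p) hp
    simp only [Set.mem_union, Set.mem_ofPred_eq, not_or, not_exists, not_and, not_not] at h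
    obtain ⟨⟨h1, h2⟩, h3⟩ := h
    have hw := p.isNonarchimedean_adicAbv (K := K) (hb p)
    have hfc : ∀ n, p.adicAbv (hb p) (f.coeff n) ≤ 1 := fun n =>
      h3 _ (Or.inl (Or.inl (Or.inl (Or.inl ⟨n, rfl⟩))))
    have hgc : ∀ n, p.adicAbv (hb p) (g.coeff n) ≤ 1 := fun n =>
      h3 _ (Or.inl (Or.inl (Or.inl (Or.inr ⟨n, rfl⟩))))
    have hqc : ∀ n, p.adicAbv (hb p) (q.coeff n) ≤ 1 := fun n =>
      h3 _ (Or.inl (Or.inl (Or.inr ⟨n, rfl⟩)))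
    have h0 : p.adicAbv (hb p) (x 0) ≤ 1 := h3 _ (Or.inr rfl)
    have hxi : ∀ m, p.adicAbv (hb p) (x m) ≤ 1 := fun m => by
      induction m with
      | zero => exact h0
      | succ m ih => rw [hx]; exact hw.apply_eval_le_one hfc ih
    refine ⟨h1, hxi, fun m => ?_⟩
    by_contra hne
    exact h1 (hw.avoids_of_apply_eval_lt_one hfc hgc hqc hgf hx h0
      (fun v hv => ⟨h3 v (Or.inl (Or.inr hv)), h2 v hv⟩) hxV
      (lt_of_le_of_ne (hw.apply_eval_le_one hgc (hxi m)) hne))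
  obtain ⟨p, hp⟩ := exists_algebraMap_notMem_asIdeal (A := A) v hu hn hs hsu
  obtain ⟨hbad, -, hp1⟩ := hgood p hp
  obtain ⟨ι, _, e, B, h⟩ := exists_integral_coordinates v hu hn hv hs hb hf hg hgf hgq hx
    (fun m h0 => by have := hp1 m; rw [h0, map_zero] at this; exact zero_ne_one this)
    (fun m p hp => (hgood p hp).2.1 m) (fun m p hp => (hgood p hp).2.2 m)
  refine hbad ((hdisc ι e B _ ?_ p).mono le_rfl hcompl)
  rintro _ ⟨m, rfl⟩
  exact h m

/-- The place defined by a maximal ideal of a Dedekind domain. -/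
noncomputable def IsDedekindDomain.HeightOneSpectrum.place {A K : Type} [CommRing A]
    [IsDedekindDomain A] [Field K] [Algebra A K] [IsFractionRing A K] {b : ℝ≥0} (hb : 1 < b)
    (p : HeightOneSpectrum A) : PlaceK K where
  v := p.adicAbv hb
  nontrivial := by
    obtain ⟨x, hx, hx0⟩ := (Submodule.ne_bot_iff _).1 p.ne_bot
    exact ⟨algebraMap A K x, (map_ne_zero_iff _ (IsFractionRing.injective A K)).2 hx0,
      ((p.adicAbv_coe_lt_one_iff hb x).2 hx).ne⟩

theorem IsDedekindDomain.HeightOneSpectrum.eq_of_equiv_place {A K : Type} [CommRing A]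
    [IsDedekindDomain A] [Field K] [Algebra A K] [IsFractionRing A K] {b : ℝ≥0} (hb : 1 < b)
    {p q : HeightOneSpectrum A} (h : PlaceK.Equiv (p.place (K := K) hb) (q.place hb)) : p = q := by
  refine HeightOneSpectrum.ext (Ideal.ext fun x => ?_)
  rw [← p.adicAbv_coe_lt_one_iff (K := K) hb, ← q.adicAbv_coe_lt_one_iff (K := K) hb]
  exact h _

theorem infinitelyManyPlaces_of_dedekind {R F A K : Type} [CommRing R] [IsDomain R]
    [IsPrincipalIdealRing R] [Field F] [Algebra R F] [IsFractionRing R F] [CommRing A]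
    [IsDedekindDomain A] [Algebra R A] [Algebra.IsIntegral R A] [Field K] [Algebra A K]
    [IsFractionRing A K] [Algebra R K] [IsScalarTower R A K] [Algebra F K] [IsScalarTower R F K]
    [FiniteDimensional F K] [CharZero K] (v : AbsoluteValue F ℝ)
    (hu : ∀ r : R, IsUnit r → v (algebraMap R F r) = 1)
    (hn : ∀ r : R, r ≠ 0 → ¬ IsUnit r → 1 < v (algebraMap R F r)) (hv : v.HasExtensions K)
    (hR : ∃ r : R, r ≠ 0 ∧ ¬ IsUnit r) {b : ℝ≥0} (hb : 1 < b)
    (hdisc : ∀ (ι : Type) [Fintype ι] (e : ι → K) (B : ℝ) (Y : Set K), (∀ y ∈ Y, ∃ c : ι → R,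
      (∀ j, v (algebraMap R F (c j)) ≤ B) ∧ y = ∑ j, algebraMap R K (c j) * e j) →
      ∀ p : HeightOneSpectrum A, (p.adicAbv (K := K) hb).Avoids Y Yᶜ)
    {κ : Subfield K} (hκ : ∀ p : HeightOneSpectrum A, (p.place (K := K) hb).IsPlaceOver κ)
    {f : K[X]} (hf : 2 ≤ f.natDegree) {α : OnePoint K} {V : Set (OnePoint K)} (hV : V.Finite)
    (hP : fwdOrbit (polyEvalP1 f) α ∩ V = ∅) :
    InfinitelyManyPlaces K κ fun w =>
      ∀ C : CompletionOf w,
        @closure _ (p1Top C.absv)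
            (fwdOrbit (polyEvalP1 (f.map C.emb)) (mapPoint C.emb α)) ∩
          (mapPoint C.emb '' V) = ∅ := by
  suffices h : ∃ T : Set (HeightOneSpectrum A), T.Infinite ∧ ∀ p ∈ T,
      ∀ C : CompletionOf (p.place (K := K) hb), @closure _ (p1Top C.absv)
        (fwdOrbit (polyEvalP1 (f.map C.emb)) (mapPoint C.emb α)) ∩ (mapPoint C.emb '' V) = ∅ by
    obtain ⟨T, hT, h⟩ := h
    have heq : ∀ p q : HeightOneSpectrum A, p.place (K := K) hb = q.place hb → p = q :=
      fun p q hpq => HeightOneSpectrum.eq_of_equiv_place (K := K) hb fun x => by rw [hpq]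
    refine ⟨_, hT.image (f := fun p => p.place (K := K) hb)
      fun p _ q _ h => heq p q h, ?_, ?_⟩
    · rintro _ ⟨p, -, rfl⟩ _ ⟨q, -, rfl⟩ hne heqv
      exact hne (by rw [HeightOneSpectrum.eq_of_equiv_place hb heqv])
    · rintro _ ⟨p, hp, rfl⟩
      exact ⟨p.isNonarchimedean_adicAbv hb, hκ p, h p hp⟩
  have hiter : ∀ (a : K) (m : ℕ), (fun c => f.eval c)^[m + 1] a =
      f.eval ((fun c => f.eval c)^[m] a) := fun a m => Function.iterate_succ_apply' _ _ _
  induction α using OnePoint.rec with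
  | infty =>
    refine ⟨_, infinite_setOf_avoids_range v hu hn hv hR (fun _ => hb) hdisc hf (x := fun m => (fun c => f.eval c)^[m] 0)
      (hiter 0) Set.finite_empty fun _ => Set.notMem_empty _, fun p _ C => ?_⟩
    refine closure_fwdOrbit_infty_inter_eq_empty C f V fun h => ?_
    rw [fwdOrbit_polyEvalP1_infty] at hP
    exact Set.eq_empty_iff_forall_notMem.1 hP _ ⟨rfl, h⟩
  | coe a =>
    refine ⟨_, infinite_setOf_avoids_range v hu hn hv hR (fun _ => hb) hdisc hf (x := fun m => (fun c => f.eval c)^[m] a)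
      (hiter a) (V := {c | (c : OnePoint K) ∈ V}) (hV.preimage OnePoint.coe_injective.injOn) fun m h => ?_,
      fun p hp C => closure_fwdOrbit_inter_eq_empty C f a V hp⟩
    rw [fwdOrbit_polyEvalP1_coe] at hP
    exact Set.eq_empty_iff_forall_notMem.1 hP _ ⟨⟨m, rfl⟩, h⟩

end Arithmetic

section Instances

open IsDedekindDomain
open scoped NNReal

theorem AbsoluteValue.avoids_compl_of_finite {K : Type} [Field K] (w : AbsoluteValue K ℝ)
    {Y : Set K} (hY : Y.Finite) : w.Avoids Y Yᶜ := by
  refine ⟨?_, fun v hv => ?_⟩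
  · obtain ⟨B, hB⟩ := (hY.image w).bddAbove
    exact ⟨B, fun x hx => hB ⟨x, hx, rfl⟩⟩
  · rcases Y.eq_empty_or_nonempty with rfl | hne
    · exact ⟨1, one_pos, by simp⟩
    · obtain ⟨y, hy, h⟩ := Set.exists_min_image Y (fun x => w (x - v)) hY hne
      exact ⟨_, w.pos (sub_ne_zero.2 fun hyv : y = v => hv (hyv ▸ hy)), h⟩

theorem IsNonarchimedean.exists_pos_le_of_mem_span {K : Type} [Field K] {w : AbsoluteValue K ℝ}
    (hw : IsNonarchimedean w) {κ : Subfield K} (hκ : ∀ c ∈ κ, c ≠ 0 → w c = 1) {W : Set K}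
    (hW : W.Finite) : ∃ ε > 0, ∀ x ∈ Submodule.span κ W, x ≠ 0 → ε ≤ w x := by
  induction W, hW using Set.Finite.induction_on with
  | empty => exact ⟨1, one_pos, fun x hx hx0 => absurd (by simpa using hx) hx0⟩
  | @insert e W _ _ ih =>
    obtain ⟨ε, hε, h⟩ := ih
    obtain ⟨δ, hδ, hδε, h'⟩ : ∃ δ > 0, δ ≤ ε ∧
        ∀ z ∈ Submodule.span κ W, e + z ≠ 0 → δ ≤ w (e + z) := by
      by_cases hz : ∃ z ∈ Submodule.span κ W, e + z ≠ 0 ∧ w (e + z) < ε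
      · obtain ⟨z₀, hz₀, hne, hlt⟩ := hz
        refine ⟨_, w.pos hne, hlt.le, fun z hz _ => not_lt.1 fun hlt' => ?_⟩
        have hne' : z - z₀ ≠ 0 := fun h0 => by
          rw [sub_eq_zero.1 h0] at hlt'
          exact hlt'.false
        have h1 := (h _ (sub_mem hz hz₀) hne').trans_eq
          (congrArg w (show z - z₀ = (e + z) + -(e + z₀) by ring))
        have h2 := hw (e + z) (-(e + z₀))
        rw [w.map_neg] at h2
        exact (h1.trans h2).not_gt (max_lt (hlt'.trans hlt) hlt)
      · push Not at hz
        exact ⟨ε, hε, le_rfl, hz⟩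
    refine ⟨δ, hδ, fun x hx hx0 => ?_⟩
    obtain ⟨a, z, hz, rfl⟩ := Submodule.mem_span_insert.1 hx
    rcases eq_or_ne a 0 with rfl | ha
    · rw [zero_smul, zero_add] at hx0 ⊢
      exact hδε.trans (h z hz hx0)
    · have heq : a • e + z = (a : K) * (e + a⁻¹ • z) := by
        have : (a : K) ≠ 0 := by simpa using ha
        rw [Subfield.smul_def, Subfield.smul_def, smul_eq_mul, smul_eq_mul, mul_add,
          Subfield.coe_inv, mul_inv_cancel_left₀ this]
      rw [heq] at hx0 ⊢
      rw [map_mul, hκ a a.2 (by simpa using ha), one_mul]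
      exact h' _ (Submodule.smul_mem _ _ hz) (right_ne_zero_of_mul hx0)

theorem IsNonarchimedean.avoids_compl_of_subset_span {K : Type} [Field K] {w : AbsoluteValue K ℝ}
    (hw : IsNonarchimedean w) {κ : Subfield K} (hκ : ∀ c ∈ κ, c ≠ 0 → w c = 1) {W Y : Set K}
    (hW : W.Finite) (hY : Y ⊆ Submodule.span κ W) : w.Avoids Y Yᶜ := by
  refine ⟨?_, fun v hv => ?_⟩
  · obtain ⟨B, hB⟩ := (hW.image w).bddAbove
    refine ⟨max B 0, fun x hxY => ?_⟩
    have hx := hY hxY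
    clear hxY
    induction hx using Submodule.span_induction with
    | mem x hx => exact (hB ⟨x, hx, rfl⟩).trans (le_max_left _ _)
    | zero => rw [map_zero]; exact le_max_right _ _
    | add x y _ _ hx hy => exact (hw x y).trans (max_le hx hy)
    | smul a x _ hx =>
      rw [Subfield.smul_def, smul_eq_mul, map_mul]
      rcases eq_or_ne (a : K) 0 with ha | ha
      · rw [ha, map_zero, zero_mul]; exact le_max_right _ _
      · rwa [hκ a a.2 ha, one_mul]
  · obtain ⟨ε, hε, h⟩ := hw.exists_pos_le_of_mem_span hκ (hW.insert v)
    refine ⟨ε, hε, fun x hx => h _ (sub_mem ?_ (Submodule.subset_span (Or.inl rfl)))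
      (sub_ne_zero.2 fun h => hv (h ▸ hx))⟩
    exact Submodule.span_mono (Set.subset_insert _ _) (hY hx)

/-- The absolute value on the rational function field with `|p| = 2 ^ deg p`. -/
noncomputable def ratFuncInftyAbv (k : Type) [Field k] : AbsoluteValue (RatFunc k) ℝ :=
  open Classical in
  { toFun := fun x => WithZeroMulInt.toNNReal (e := 2) two_ne_zero (RatFunc.inftyValuation k x)
    map_mul' := fun x y => by simp
    nonneg' := fun x => NNReal.zero_le_coe
    eq_zero' := fun x => by simp
    add_le' := fun x y => by
      classical
      have h := (WithZeroMulInt.toNNReal_strictMono (one_lt_two (α := ℝ≥0))).monotone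
        ((RatFunc.inftyValuation k).map_add x y)
      rw [(WithZeroMulInt.toNNReal_strictMono (one_lt_two (α := ℝ≥0))).monotone.map_max] at h
      exact_mod_cast h.trans (max_le_add_of_nonneg bot_le bot_le) }

theorem isNonarchimedean_ratFuncInftyAbv (k : Type) [Field k] :
    IsNonarchimedean (ratFuncInftyAbv k) := fun x y => by
  classical
  have h := (WithZeroMulInt.toNNReal_strictMono (one_lt_two (α := ℝ≥0))).monotone
    ((RatFunc.inftyValuation k).map_add x y)
  rw [(WithZeroMulInt.toNNReal_strictMono (one_lt_two (α := ℝ≥0))).monotone.map_max] at h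
  exact_mod_cast h

theorem ratFuncInftyAbv_algebraMap {k : Type} [Field k] {p : k[X]} (hp : p ≠ 0) :
    ratFuncInftyAbv k (algebraMap k[X] (RatFunc k) p) = 2 ^ p.natDegree := by
  classical
  change ((WithZeroMulInt.toNNReal (e := 2) two_ne_zero
    (RatFunc.inftyValuationDef k (algebraMap k[X] (RatFunc k) p)) : ℝ≥0) : ℝ) = _
  rw [RatFunc.inftyValuation.polynomial k hp, WithZeroMulInt.toNNReal_neg_apply _ WithZero.exp_ne_zero]
  have : WithZero.unzero (WithZero.exp_ne_zero (a := (p.natDegree : ℤ))) =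
      Multiplicative.ofAdd (p.natDegree : ℤ) := WithZero.unzero_coe _
  rw [this]
  simp

theorem infinitelyManyPlaces_of_numberField {K : Type} [Field K] [NumberField K] {κ : Subfield K}
    {f : K[X]} (hf : 2 ≤ f.natDegree) {α : OnePoint K} {V : Set (OnePoint K)} (hV : V.Finite)
    (hP : fwdOrbit (polyEvalP1 f) α ∩ V = ∅) :
    InfinitelyManyPlaces K κ fun w =>
      ∀ C : CompletionOf w,
        @closure _ (p1Top C.absv)
            (fwdOrbit (polyEvalP1 (f.map C.emb)) (mapPoint C.emb α)) ∩
          (mapPoint C.emb '' V) = ∅ := by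
  refine infinitelyManyPlaces_of_dedekind (R := ℤ) (F := ℚ) (A := NumberField.RingOfIntegers K)
    Rat.AbsoluteValue.real (fun r hr => ?_) (fun r hr hru => ?_) (hasExtensions_abs_rat K)
    ⟨2, two_ne_zero, by decide⟩ (one_lt_two (α := ℝ≥0)) (fun ι _ e B Y hY p => ?_)
    (fun _ => Or.inl inferInstance) hf hV hP
  · rw [Rat.AbsoluteValue.real_eq_abs]
    rcases Int.isUnit_iff.1 hr with rfl | rfl <;> simp
  · rw [Rat.AbsoluteValue.real_eq_abs]
    have h1 : 0 < |r| := abs_pos.2 hr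
    have h2 : |r| ≠ 1 := fun h => hru (Int.isUnit_iff_abs_eq.2 h)
    have h3 : 1 < |r| := by omega
    simpa using mod_cast h3
  · refine AbsoluteValue.avoids_compl_of_finite _ ?_
    have hfin : (Set.univ.pi fun _ : ι => Set.Icc (-⌈B⌉) ⌈B⌉).Finite :=
      Set.Finite.pi fun _ => Set.finite_Icc _ _
    refine (hfin.image fun c => ∑ j, algebraMap ℤ K (c j) * e j).subset fun y hy => ?_
    obtain ⟨c, hc, rfl⟩ := hY y hy
    refine ⟨c, fun j _ => ?_, rfl⟩
    have h := hc j
    rw [Rat.AbsoluteValue.real_eq_abs] at h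
    refine abs_le.1 (Int.cast_le (R := ℝ).1 (le_trans ?_ (Int.le_ceil B)))
    simpa using h

theorem infinitelyManyPlaces_of_functionField {K : Type} [Field K] [CharZero K] {κ : Subfield K}
    {t : K} (ht : Transcendental κ t) (hfin : FiniteDimensional (IntermediateField.adjoin κ {t}) K)
    {f : K[X]} (hf : 2 ≤ f.natDegree) {α : OnePoint K} {V : Set (OnePoint K)} (hV : V.Finite)
    (hP : fwdOrbit (polyEvalP1 f) α ∩ V = ∅) :
    InfinitelyManyPlaces K κ fun w =>
      ∀ C : CompletionOf w,
        @closure _ (p1Top C.absv)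
            (fwdOrbit (polyEvalP1 (f.map C.emb)) (mapPoint C.emb α)) ∩
          (mapPoint C.emb '' V) = ∅ := by
  let φ := RatFunc.algEquivOfTranscendental t ht
  let : Algebra κ[X] K := (aeval t).toAlgebra
  let : Algebra (RatFunc κ) K :=
    ((algebraMap (IntermediateField.adjoin κ {t}) K).comp φ.toRingEquiv.toRingHom).toAlgebra
  have : IsScalarTower κ[X] (RatFunc κ) K := IsScalarTower.of_algebraMap_eq fun p => by
    change aeval t p = ((φ (algebraMap _ _ p) : IntermediateField.adjoin κ {t}) : K)
    rw [RatFunc.algEquivOfTranscendental_algebraMap]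
    simp
  have : FiniteDimensional (RatFunc κ) K :=
    Module.Finite.of_equiv_equiv φ.symm.toRingEquiv (RingEquiv.refl K) <| by
      ext x
      change ((φ (φ.symm x) : IntermediateField.adjoin κ {t}) : K) = x
      rw [φ.apply_symm_apply]
  have hC : ∀ c : κ, algebraMap κ[X] K (C c) = c := fun c => aeval_C t c
  have : CharZero κ := (algebraMap κ K).charZero
  have : CharZero (RatFunc κ) := (algebraMap (RatFunc κ) K).charZero
  have : IsFractionRing (integralClosure κ[X] K) K :=
    integralClosure.isFractionRing_of_finite_extension (RatFunc κ) K
  have : IsDedekindDomain (integralClosure κ[X] K) :=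
    integralClosure.isDedekindDomain κ[X] (RatFunc κ) K
  have htriv : ∀ (p : HeightOneSpectrum (integralClosure κ[X] K)) (c : K), c ∈ κ → c ≠ 0 →
      p.adicAbv (K := K) (one_lt_two (α := ℝ≥0)) c = 1 := fun p c hc hc0 => by
    have hle : ∀ c : κ, p.adicAbv (K := K) (one_lt_two (α := ℝ≥0)) c ≤ 1 := fun c => by
      rw [← hC, IsScalarTower.algebraMap_apply κ[X] (integralClosure κ[X] K) K]
      exact p.adicAbv_coe_le_one _ _
    refine (hle ⟨c, hc⟩).antisymm ?_
    have h := hle ⟨c⁻¹, inv_mem hc⟩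
    rw [map_inv₀] at h
    exact (inv_le_one₀ ((p.adicAbv _).pos hc0)).1 h
  refine infinitelyManyPlaces_of_dedekind (R := κ[X]) (F := RatFunc κ)
    (A := integralClosure κ[X] K) (ratFuncInftyAbv κ) (fun r hr => ?_) (fun r hr hru => ?_)
    ((ratFuncInftyAbv κ).hasExtensions_of_isNonarchimedean (isNonarchimedean_ratFuncInftyAbv κ)
      (algebraMap κ[X] (RatFunc κ) X) ?_)
    ⟨X, X_ne_zero, not_isUnit_X⟩ (one_lt_two (α := ℝ≥0)) (fun ι _ e B Y hY p => ?_)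
    (fun p => Or.inr (htriv p)) hf hV hP
  · rw [ratFuncInftyAbv_algebraMap hr.ne_zero, natDegree_eq_zero_of_isUnit hr, pow_zero]
  · rw [ratFuncInftyAbv_algebraMap hr]
    refine one_lt_pow₀ one_lt_two fun h => hru ?_
    rw [isUnit_iff_degree_eq_zero, degree_eq_natDegree hr, h]
    rfl
  · rw [ratFuncInftyAbv_algebraMap X_ne_zero, natDegree_X]
    norm_num
  · refine (p.isNonarchimedean_adicAbv _).avoids_compl_of_subset_span (htriv p)
      (W := Set.range fun i : Fin ⌈B⌉₊ × ι => algebraMap κ[X] K (X ^ (i.1 : ℕ)) * e i.2)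
      (Set.finite_range _) fun y hy => ?_
    obtain ⟨c, hc, rfl⟩ := hY y hy
    refine sum_mem fun j _ => ?_
    rcases eq_or_ne (c j) 0 with h0 | h0
    · rw [h0, map_zero, zero_mul]
      exact zero_mem _
    have hdeg : (c j).natDegree < ⌈B⌉₊ := by
      have h := hc j
      rw [ratFuncInftyAbv_algebraMap h0] at h
      have h2 : ((c j).natDegree : ℝ) < 2 ^ (c j).natDegree := mod_cast Nat.lt_two_pow_self
      exact Nat.cast_lt (α := ℝ).1 ((h2.trans_le h).trans_le (Nat.le_ceil B))
    rw [(c j).as_sum_range' _ hdeg, map_sum, Finset.sum_mul]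
    refine sum_mem fun i hi => ?_
    rw [← C_mul_X_pow_eq_monomial, map_mul, hC, mul_assoc]
    exact Submodule.smul_mem _ ((c j).coeff i)
      (Submodule.subset_span ⟨(⟨i, Finset.mem_range.1 hi⟩, j), rfl⟩)

end Instances

/-- **Avoidance of a finite set at infinitely many places** (Lemma 3.14).

Let `K` be a number field or a function field of characteristic 0, and `f ∈ K[X]` of
degree at least 2. Let `α ∈ P^1(K)` and let `V` be a finite subset of `P^1(K)` such that
the forward `f`-orbit of `α` does not meet `V`. Then there are infinitely many
non-archimedean places `𝔭` of `K` such that the `𝔭`-adic closure of the orbit in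
`P^1(K_𝔭)` does not meet `V`. -/
theorem orbit_closure_avoids_finite_set
    (K : Type) [Field K] (κ : Subfield K)
    (hK : NumberFieldOrFunctionFieldOver K κ)
    (f : Polynomial K) (hf : 2 ≤ f.natDegree)
    (α : OnePoint K) (V : Set (OnePoint K)) (hVfin : V.Finite)
    (hP : fwdOrbit (polyEvalP1 f) α ∩ V = ∅) :
    InfinitelyManyPlaces K κ fun w =>
      ∀ C : CompletionOf w,
        @closure _ (p1Top C.absv)
            (fwdOrbit (polyEvalP1 (f.map C.emb)) (mapPoint C.emb α)) ∩
          (mapPoint C.emb '' V) = ∅ := by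
  rcases hK with _ | ⟨_, ⟨t, ht, hfin⟩, -⟩
  · exact infinitelyManyPlaces_of_numberField hf hVfin hP
  · exact infinitelyManyPlaces_of_functionField ht hfin hf hVfin hP
end
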